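/- Let C ⊂ 𝕋² be a smooth curve with nowhere-vanishing curvature. There exist constants c > 0 and λ₀ > 0, depending only on C, such that for every λ ≥ λ₀ and every nonzero real-valued eigenfunction F of the Laplacian on 𝕋² with eigenvalue λ², the number of nodal intersections satisfies N_{F,C} ≥ c·λ·(∫_C |F| / ‖F‖₂)⁵. -/

import Mathlib

open MeasureTheory Real

noncomputable section

/-- The Euclidean norm of a vector in `ℝ × ℝ`. -/
def e2 (x : ℝ × ℝ) : ℝ := Real.sqrt (x.1 ^ 2 + x.2 ^ 2)

/-- The integer vector `μ` viewed as a vector in `ℝ × ℝ`. -/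
def iv (μ : ℤ × ℤ) : ℝ × ℝ := ((μ.1 : ℝ), (μ.2 : ℝ))

/-- The set of lattice points on the circle of radius `lam`. -/
def Elat (lam : ℝ) : Finset (ℤ × ℤ) := by
  classical
  exact (Finset.Icc (-⌈lam⌉, -⌈lam⌉) (⌈lam⌉, ⌈lam⌉)).filter
    (fun μ => (μ.1 : ℝ) ^ 2 + (μ.2 : ℝ) ^ 2 = lam ^ 2)

/-- `B_lam`: the maximal number of lattice points on the circle of radius `lam`
lying in an arc of length `√lam`. -/
def Bmax (lam : ℝ) : ℕ := by
  classical
  exact sSup {n : ℕ | ∃ x : ℝ × ℝ, e2 x = lam ∧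
    n = ((Elat lam).filter fun ξ => e2 (iv ξ - x) ≤ Real.sqrt lam).card}

/-- The eigenfunction `F(x) = ∑_{μ ∈ E_lam} a_μ e^{i⟨μ,x⟩}` of the Laplacian on the torus
`ℝ²/(2πℤ²)` with eigenvalue `lam²`. -/
def efn (lam : ℝ) (a : ℤ × ℤ → ℂ) (x : ℝ × ℝ) : ℂ :=
  ∑ μ ∈ Elat lam, a μ *
    Complex.exp (Complex.I * Complex.ofReal ((μ.1 : ℝ) * x.1 + (μ.2 : ℝ) * x.2))

/-- The `L²` norm of `F` over the torus, realized as the square `[0,2π]²`. -/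
def l2T (F : ℝ × ℝ → ℂ) : ℝ :=
  Real.sqrt (∫ x in (Set.Icc (0:ℝ) (2 * π)) ×ˢ (Set.Icc (0:ℝ) (2 * π)), ‖F x‖ ^ 2)

/-- The Gaussian integers of norm `n`. -/
def gaussReps (n : ℕ) : Set GaussianInt := {z | z.norm = (n : ℤ)}

theorem gaussReps_finite (n : ℕ) : (gaussReps n).Finite := by
  have : (((Set.Icc (-(n:ℤ)) n) ×ˢ (Set.Icc (-(n:ℤ)) n)).image
      (fun q : ℤ × ℤ => (⟨q.1, q.2⟩ : GaussianInt))).Finite :=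
    ((Set.finite_Icc _ _).prod (Set.finite_Icc _ _)).image _
  refine this.subset ?_
  intro z hz
  simp only [gaussReps, Set.mem_ofPred_eq, Zsqrtd.norm_def] at hz
  refine ⟨(z.re, z.im), ⟨⟨?_, ?_⟩, ⟨?_, ?_⟩⟩, rfl⟩ <;>
    nlinarith [sq_nonneg z.re, sq_nonneg z.im, sq_nonneg (z.re - 1), sq_nonneg (z.re + 1),
      sq_nonneg (z.im - 1), sq_nonneg (z.im + 1)]

theorem gaussReps_mul_ncard_le {a b : ℕ} (ha : 0 < a) (hb : 0 < b) (hab : a.Coprime b) :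
    (gaussReps (a * b)).ncard ≤ (gaussReps a).ncard * (gaussReps b).ncard := by
  have hsub : gaussReps (a * b) ⊆
      (gaussReps a ×ˢ gaussReps b).image (fun q : GaussianInt × GaussianInt => q.1 * q.2) := by
    intro z hz
    simp only [gaussReps, Set.mem_ofPred_eq] at hz
    have hdvd : z ∣ (a : GaussianInt) * (b : GaussianInt) := by
      refine ⟨star z, ?_⟩
      rw [← Zsqrtd.norm_eq_mul_conj, hz]
      push_cast; rfl
    obtain ⟨x, y, hx, hy, rfl⟩ := exists_dvd_and_dvd_of_dvd_mul hdvd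
    have hNx : x.norm ∣ (a : ℤ) * a := by
      obtain ⟨w, hw⟩ := hx
      refine ⟨w.norm, ?_⟩
      rw [← Zsqrtd.norm_mul, ← hw, Zsqrtd.norm_natCast]
    have hNy : y.norm ∣ (b : ℤ) * b := by
      obtain ⟨w, hw⟩ := hy
      refine ⟨w.norm, ?_⟩
      rw [← Zsqrtd.norm_mul, ← hw, Zsqrtd.norm_natCast]
    have hN : x.norm * y.norm = (a : ℤ) * b := by
      rw [← Zsqrtd.norm_mul, hz]; push_cast; rfl
    have hc : IsCoprime (a : ℤ) (b : ℤ) := Nat.isCoprime_iff_coprime.mpr hab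
    have h1 : x.norm ∣ (a : ℤ) := by
      have : IsCoprime x.norm (b : ℤ) :=
        IsCoprime.of_isCoprime_of_dvd_left (IsCoprime.mul_left hc hc) hNx
      exact this.dvd_of_dvd_mul_right ⟨y.norm, hN.symm⟩
    have h2 : y.norm ∣ (b : ℤ) := by
      have : IsCoprime y.norm (a : ℤ) :=
        IsCoprime.of_isCoprime_of_dvd_left (IsCoprime.mul_left hc.symm hc.symm) hNy
      exact this.dvd_of_dvd_mul_left ⟨x.norm, by rw [← hN, mul_comm]⟩
    have h1' := Int.le_of_dvd (by exact_mod_cast ha) h1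
    have h2' := Int.le_of_dvd (by exact_mod_cast hb) h2
    have hx0 := GaussianInt.norm_nonneg x
    have hy0 := GaussianInt.norm_nonneg y
    have ha' : (0:ℤ) < a := by exact_mod_cast ha
    have hb' : (0:ℤ) < b := by exact_mod_cast hb
    refine ⟨(x, y), ⟨?_, ?_⟩, rfl⟩
    · show x.norm = (a:ℤ)
      by_contra hne
      have : x.norm < a := lt_of_le_of_ne h1' hne
      nlinarith
    · show y.norm = (b:ℤ)
      by_contra hne
      have : y.norm < b := lt_of_le_of_ne h2' hne
      nlinarith
  have hfin := (gaussReps_finite a).prod (gaussReps_finite b)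
  calc (gaussReps (a * b)).ncard ≤ _ := Set.ncard_le_ncard hsub (hfin.image _)
    _ ≤ (gaussReps a ×ˢ gaussReps b).ncard := Set.ncard_image_le hfin
    _ = _ := Set.ncard_prod

theorem exists_eq_mul_pow_of_norm_prime_pow {p : ℕ} (hp : p.Prime) :
    ∃ ρ : GaussianInt, ∀ k : ℕ, ∀ z : GaussianInt, z.norm = (p : ℤ) ^ k →
      ∃ u : GaussianInt, u.norm = 1 ∧ ∃ i ≤ k, ∃ j ≤ k, z = u * ρ ^ i * (star ρ) ^ j := by
  have hpu : ¬ IsUnit (p : GaussianInt) := by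
    rw [← Zsqrtd.norm_eq_one_iff, Zsqrtd.norm_natCast, Int.natAbs_mul, Int.natAbs_natCast]
    nlinarith [hp.two_le]
  have hp0 : (p : GaussianInt) ≠ 0 := by exact_mod_cast hp.ne_zero
  obtain ⟨ρ, hρ, hρp⟩ := WfDvdMonoid.exists_irreducible_factor hpu hp0
  refine ⟨ρ, ?_⟩
  have hNρ1 : ρ.norm.natAbs ≠ 1 := by
    rw [Ne, Zsqrtd.norm_eq_one_iff]; exact hρ.not_isUnit
  have hpN : (p : ℤ) ∣ ρ.norm := by
    have h : ρ.norm.natAbs ∣ p ^ 2 := by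
      obtain ⟨w, hw⟩ := hρp
      have : (p : ℤ) * p = ρ.norm * w.norm := by
        rw [← Zsqrtd.norm_mul, ← hw, Zsqrtd.norm_natCast]
      rw [← Int.natAbs_natCast (p ^ 2)]
      refine Int.natAbs_dvd_natAbs.mpr ⟨w.norm, ?_⟩
      push_cast; rw [← this]; ring
    obtain ⟨m, -, hm⟩ := (Nat.dvd_prime_pow hp).mp h
    rw [← Int.natCast_dvd_natCast] at *
    rcases m with _ | m
    · exact absurd (by simpa using hm) hNρ1
    · rw [← Int.dvd_natAbs, hm]
      push_cast
      exact ⟨p ^ m, by ring⟩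
  have hdivρ : ∀ z : GaussianInt, ∀ k : ℕ, k ≠ 0 → z.norm = (p : ℤ) ^ k → ρ ∣ z ∨ star ρ ∣ z := by
    intro z k hk hz
    have hzu : ¬ IsUnit z := by
      rw [← Zsqrtd.norm_eq_one_iff, hz, Int.natAbs_pow, Int.natAbs_natCast]
      exact (Nat.one_lt_pow hk hp.one_lt).ne'
    have hz0 : z ≠ 0 := by
      rintro rfl
      rw [Zsqrtd.norm_zero] at hz
      exact pow_ne_zero k (by exact_mod_cast hp.ne_zero : (p:ℤ) ≠ 0) hz.symm
    obtain ⟨σ, hσ, hσz⟩ := WfDvdMonoid.exists_irreducible_factor hzu hz0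
    have hσP : Prime σ := hσ.prime
    have h1 : σ ∣ (p : GaussianInt) ^ k := by
      have : z * star z = (p : GaussianInt) ^ k := by
        rw [← Zsqrtd.norm_eq_mul_conj, hz]; push_cast; rfl
      rw [← this]; exact hσz.mul_right _
    have h2 : σ ∣ ρ * star ρ := by
      refine (hσP.dvd_of_dvd_pow h1).trans ?_
      rw [← Zsqrtd.norm_eq_mul_conj]
      obtain ⟨w, hw⟩ := hpN
      rw [hw]
      exact ⟨w, by push_cast; rfl⟩
    rcases hσP.dvd_or_dvd h2 with h | h
    · left
      exact ((hσ.associated_of_dvd hρ h).symm.dvd).trans hσz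
    · right
      obtain ⟨w, hw⟩ := h
      have hρ' : ρ = star σ * star w := by rw [← star_star ρ, hw, star_mul']
      rcases hρ.isUnit_or_isUnit hρ' with h | h
      · exact absurd (by simpa using h.star) hσ.not_isUnit
      · have hw' : IsUnit w := by simpa using h.star
        rw [hw]
        exact hw'.mul_right_dvd.mpr hσz
  intro k
  induction k using Nat.strong_induction_on with
  | _ k ih =>
    intro z hz
    rcases Nat.eq_zero_or_pos k with rfl | hk
    · exact ⟨z, by simpa using hz, 0, le_rfl, 0, le_rfl, by simp⟩
    have key : ∀ τ z' : GaussianInt, τ.norm = ρ.norm → z = τ * z' →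
        ∃ k' < k, z'.norm = (p : ℤ) ^ k' := by
      intro τ z' hτ hzz
      have hN : ρ.norm * z'.norm = (p : ℤ) ^ k := by rw [← hτ, ← Zsqrtd.norm_mul, ← hzz, hz]
      have hN' : ρ.norm.natAbs * z'.norm.natAbs = p ^ k := by
        rw [← Int.natAbs_mul, hN, Int.natAbs_pow, Int.natAbs_natCast]
      obtain ⟨k', hk', hk''⟩ := (Nat.dvd_prime_pow hp).mp (Dvd.intro_left _ hN')
      refine ⟨k', lt_of_le_of_ne hk' ?_, ?_⟩
      · rintro rfl
        rw [hk''] at hN'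
        exact hNρ1 (Nat.eq_of_mul_eq_mul_right (pow_pos hp.pos _) (by rw [hN', one_mul]))
      · rw [← GaussianInt.abs_natCast_norm, hk'']; push_cast; rfl
    rcases hdivρ z k hk.ne' hz with ⟨z', hz'⟩ | ⟨z', hz'⟩
    · obtain ⟨k', hk', hn⟩ := key ρ z' rfl hz'
      obtain ⟨u, hu, i, hi, j, hj, h⟩ := ih k' hk' z' hn
      exact ⟨u, hu, i + 1, by omega, j, by omega, by rw [hz', h]; ring⟩
    · obtain ⟨k', hk', hn⟩ := key (star ρ) z' (Zsqrtd.norm_conj ρ) hz'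
      obtain ⟨u, hu, i, hi, j, hj, h⟩ := ih k' hk' z' hn
      exact ⟨u, hu, i, by omega, j + 1, by omega, by rw [hz', h]; ring⟩

theorem gaussReps_prime_pow_ncard_le {p : ℕ} (hp : p.Prime) (k : ℕ) :
    (gaussReps (p ^ k)).ncard ≤ (gaussReps 1).ncard * (k + 1) ^ 2 := by
  obtain ⟨ρ, hρ⟩ := exists_eq_mul_pow_of_norm_prime_pow hp
  have hsub : gaussReps (p ^ k) ⊆ (gaussReps 1 ×ˢ (Set.Iic k ×ˢ Set.Iic k)).image
      (fun q : GaussianInt × ℕ × ℕ => q.1 * ρ ^ q.2.1 * (star ρ) ^ q.2.2) := by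
    intro z hz
    obtain ⟨u, hu, i, hi, j, hj, h⟩ := hρ k z (by simpa [gaussReps] using hz)
    exact ⟨(u, i, j), ⟨by simpa [gaussReps] using hu, hi, hj⟩, h.symm⟩
  have hfin := (gaussReps_finite 1).prod ((Set.finite_Iic k).prod (Set.finite_Iic k))
  calc (gaussReps (p ^ k)).ncard ≤ _ := Set.ncard_le_ncard hsub (hfin.image _)
    _ ≤ _ := Set.ncard_image_le hfin
    _ = _ := by
      rw [Set.ncard_prod, Set.ncard_prod]
      have : (Set.Iic k).ncard = k + 1 := by
        rw [← Finset.coe_Iic, Set.ncard_coe_finset, Nat.card_Iic]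
      rw [this]; ring

theorem exists_sq_le_mul_two_rpow (c : ℝ) {ε : ℝ} (hε : 0 < ε) :
    ∃ K : ℝ, 1 ≤ K ∧ ∀ k : ℕ, c * ((k : ℝ) + 1) ^ 2 ≤ K * ((2 : ℝ) ^ k) ^ ε := by
  have hr : |((2 : ℝ) ^ ε)⁻¹| < 1 := by
    rw [abs_of_pos (by positivity)]
    exact inv_lt_one_of_one_lt₀ (Real.one_lt_rpow (by norm_num) hε)
  have ht := tendsto_pow_const_mul_const_pow_of_abs_lt_one 2 hr
  obtain ⟨M, hM⟩ := ht.bddAbove_range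
  have hM' : ∀ k : ℕ, (k : ℝ) ^ 2 * (((2 : ℝ) ^ ε)⁻¹) ^ k ≤ M := fun k => hM ⟨k, rfl⟩
  refine ⟨max 1 (|c| * (2 * M + 2)), le_max_left _ _, fun k => ?_⟩
  have h2 : ((2 : ℝ) ^ k) ^ ε = ((2 : ℝ) ^ ε) ^ k := by
    rw [← Real.rpow_natCast, ← Real.rpow_natCast, ← Real.rpow_mul (by norm_num),
      ← Real.rpow_mul (by norm_num), mul_comm]
  have hX : (1 : ℝ) ≤ ((2 : ℝ) ^ ε) ^ k :=
    one_le_pow₀ (Real.one_le_rpow (by norm_num) hε.le)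
  have h3 : (k : ℝ) ^ 2 ≤ M * ((2 : ℝ) ^ ε) ^ k := by
    have := hM' k
    rwa [inv_pow, ← div_eq_mul_inv, div_le_iff₀ (by positivity)] at this
  rw [h2]
  calc c * ((k : ℝ) + 1) ^ 2 ≤ |c| * ((k : ℝ) + 1) ^ 2 := by gcongr; exact le_abs_self c
    _ ≤ |c| * (2 * (M * ((2 : ℝ) ^ ε) ^ k) + 2 * ((2 : ℝ) ^ ε) ^ k) := by
        gcongr; nlinarith [sq_nonneg ((k : ℝ) - 1)]
    _ = (|c| * (2 * M + 2)) * ((2 : ℝ) ^ ε) ^ k := by ring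
    _ ≤ _ := by gcongr; exact le_max_right _ _

theorem exists_gaussReps_ncard_le_rpow {ε : ℝ} (hε : 0 < ε) :
    ∃ C : ℝ, 1 ≤ C ∧ ∀ n : ℕ, 0 < n → ((gaussReps n).ncard : ℝ) ≤ C * (n : ℝ) ^ ε := by
  set c : ℝ := ((gaussReps 1).ncard : ℝ) with hc
  have hc1 : 1 ≤ c := by
    rw [hc, Nat.one_le_cast, Nat.one_le_iff_ne_zero, Ne, Set.ncard_eq_zero (gaussReps_finite 1)]
    exact Set.Nonempty.ne_empty ⟨1, by simp [gaussReps]⟩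
  obtain ⟨K, hK1, hK⟩ := exists_sq_le_mul_two_rpow c hε
  obtain ⟨P, hP⟩ : ∃ P : ℕ, ∀ p : ℕ, P ≤ p → 4 * c ≤ (p : ℝ) ^ ε := by
    have := ((tendsto_rpow_atTop hε).comp tendsto_natCast_atTop_atTop).eventually_ge_atTop (4 * c)
    simpa [Filter.eventually_atTop] using this
  have main : ∀ n : ℕ, 0 < n → ((gaussReps n).ncard : ℝ) ≤
      c * K ^ ((n.primeFactors.filter (· < P)).card) * (n : ℝ) ^ ε ∧
      (n ≠ 1 → ((gaussReps n).ncard : ℝ) ≤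
        K ^ ((n.primeFactors.filter (· < P)).card) * (n : ℝ) ^ ε) := by
    intro n
    suffices h : 0 < n → (n ≠ 1 → ((gaussReps n).ncard : ℝ) ≤
        K ^ ((n.primeFactors.filter (· < P)).card) * (n : ℝ) ^ ε) by
      intro hn
      refine ⟨?_, h hn⟩
      by_cases h1 : n = 1
      · subst h1; simp [hc]
      · refine (h hn h1).trans ?_
        rw [mul_assoc]
        exact le_mul_of_one_le_left (by positivity) hc1
    induction n using Nat.recOnPosPrimePosCoprime with
    | zero => intro h; exact absurd h (lt_irrefl _)
    | one => intro _ h; exact absurd rfl h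
    | prime_pow p k hp hk =>
      intro _ _
      have h1 : ((gaussReps (p ^ k)).ncard : ℝ) ≤ c * ((k : ℝ) + 1) ^ 2 := by
        rw [hc]; exact_mod_cast gaussReps_prime_pow_ncard_le hp k
      refine h1.trans ?_
      rw [Nat.primeFactors_prime_pow hk.ne' hp, Finset.filter_singleton]
      have hpε : (((p ^ k : ℕ) : ℝ)) ^ ε = ((p : ℝ) ^ ε) ^ k := by
        push_cast
        rw [← Real.rpow_natCast, ← Real.rpow_natCast, ← Real.rpow_mul (by positivity),
          ← Real.rpow_mul (by positivity), mul_comm]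
      split_ifs with hpP
      · rw [Finset.card_singleton, pow_one]
        refine (hK k).trans ?_
        push_cast
        gcongr
        exact_mod_cast hp.two_le
      · rw [Finset.card_empty, pow_zero, one_mul, hpε]
        have h4 : (4 * c) ^ k ≤ ((p : ℝ) ^ ε) ^ k := by
          gcongr; exact hP p (not_lt.mp hpP)
        refine le_trans ?_ h4
        rw [mul_pow]
        have h5 : ((k : ℝ) + 1) ^ 2 ≤ 4 ^ k := by
          have : k + 1 ≤ 2 ^ k := Nat.lt_two_pow_self
          have h6 : ((k : ℝ) + 1) ≤ 2 ^ k := by exact_mod_cast this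
          calc ((k : ℝ) + 1) ^ 2 ≤ (2 ^ k) ^ 2 := by gcongr
            _ = 4 ^ k := by rw [← pow_mul, mul_comm, pow_mul]; norm_num
        have h7 : c ≤ c ^ k := le_self_pow₀ hc1 hk.ne'
        calc c * ((k : ℝ) + 1) ^ 2 ≤ c ^ k * 4 ^ k := by gcongr
          _ = _ := mul_comm _ _
    | coprime a b ha hb hab iha ihb =>
      intro _ _
      have iha := iha (by omega) (by omega)
      have ihb := ihb (by omega) (by omega)
      have hcard : ((a * b).primeFactors.filter (· < P)).card =
          (a.primeFactors.filter (· < P)).card + (b.primeFactors.filter (· < P)).card := by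
        rw [hab.primeFactors_mul, Finset.filter_union, Finset.card_union_of_disjoint]
        exact Finset.disjoint_filter_filter hab.disjoint_primeFactors
      calc ((gaussReps (a * b)).ncard : ℝ)
          ≤ ((gaussReps a).ncard : ℝ) * (gaussReps b).ncard := by
            exact_mod_cast gaussReps_mul_ncard_le (by omega) (by omega) hab
        _ ≤ (K ^ ((a.primeFactors.filter (· < P)).card) * (a : ℝ) ^ ε) *
            (K ^ ((b.primeFactors.filter (· < P)).card) * (b : ℝ) ^ ε) := by gcongr
        _ = _ := by
            rw [hcard, pow_add]
            push_cast
            rw [Real.mul_rpow (by positivity) (by positivity)]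
            ring
  refine ⟨c * K ^ P, one_le_mul_of_one_le_of_one_le hc1 (one_le_pow₀ hK1), fun n hn => ?_⟩
  refine (main n hn).1.trans ?_
  gcongr
  calc ((n.primeFactors.filter (· < P)).card) ≤ (Finset.range P).card := by
        apply Finset.card_le_card
        intro p hp
        simpa using (Finset.mem_filter.mp hp).2
    _ = P := Finset.card_range P

theorem mem_Elat {lam : ℝ} {μ : ℤ × ℤ} :
    μ ∈ Elat lam ↔ (μ ∈ Finset.Icc (-⌈lam⌉, -⌈lam⌉) (⌈lam⌉, ⌈lam⌉) ∧
      (μ.1 : ℝ) ^ 2 + (μ.2 : ℝ) ^ 2 = lam ^ 2) := by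
  classical
  unfold Elat
  exact Finset.mem_filter

theorem sq_add_sq_of_mem_Elat {lam : ℝ} {μ : ℤ × ℤ} (h : μ ∈ Elat lam) :
    (μ.1 : ℝ) ^ 2 + (μ.2 : ℝ) ^ 2 = lam ^ 2 := (mem_Elat.mp h).2

theorem neg_mem_Elat {lam : ℝ} {μ : ℤ × ℤ} (h : μ ∈ Elat lam) : -μ ∈ Elat lam := by
  rw [mem_Elat] at h ⊢
  obtain ⟨h1, h2⟩ := h
  rw [Finset.mem_Icc, Prod.le_def, Prod.le_def] at h1 ⊢
  simp only [Prod.fst_neg, Prod.snd_neg, Int.cast_neg, neg_sq] at *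
  exact ⟨⟨⟨by linarith [h1.2.1], by linarith [h1.2.2]⟩,
    ⟨by linarith [h1.1.1], by linarith [h1.1.2]⟩⟩, h2⟩

theorem exists_card_Elat_le_rpow {ε : ℝ} (hε : 0 < ε) :
    ∃ C : ℝ, 1 ≤ C ∧ ∀ lam : ℝ, 0 < lam → ((Elat lam).card : ℝ) ≤ C * lam ^ ε := by
  obtain ⟨C, hC1, hC⟩ := exists_gaussReps_ncard_le_rpow (half_pos hε)
  refine ⟨C, hC1, fun lam hlam => ?_⟩
  rcases (Elat lam).eq_empty_or_nonempty with h | ⟨μ, hμ⟩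
  · rw [h]; simp; positivity
  obtain ⟨n, hn⟩ : ∃ n : ℕ, (n : ℝ) = lam ^ 2 := by
    refine ⟨(μ.1 ^ 2 + μ.2 ^ 2).natAbs, ?_⟩
    rw [← sq_add_sq_of_mem_Elat hμ, Nat.cast_natAbs, abs_of_nonneg (by positivity)]
    push_cast; rfl
  have hn0 : 0 < n := by
    have : (0 : ℝ) < n := by rw [hn]; positivity
    exact_mod_cast this
  have hcard : (Elat lam).card ≤ (gaussReps n).ncard := by
    rw [← Set.ncard_coe_finset]
    refine Set.ncard_le_ncard_of_injOn (fun μ : ℤ × ℤ => (⟨μ.1, μ.2⟩ : GaussianInt)) ?_ ?_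
      (gaussReps_finite n)
    · intro ν hν
      have h1 := sq_add_sq_of_mem_Elat hν
      rw [← hn] at h1
      have h2 : ν.1 ^ 2 + ν.2 ^ 2 = (n : ℤ) := by exact_mod_cast h1
      simp only [gaussReps, Set.mem_ofPred_eq, Zsqrtd.norm_def]
      rw [← h2]; ring
    · intro x _ y _ h
      simp only [Zsqrtd.mk.injEq] at h
      exact Prod.ext h.1 h.2
  calc ((Elat lam).card : ℝ) ≤ (gaussReps n).ncard := by exact_mod_cast hcard
    _ ≤ C * (n : ℝ) ^ (ε / 2) := hC n hn0
    _ = C * lam ^ ε := by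
      rw [hn, ← Real.rpow_natCast, ← Real.rpow_mul hlam.le]
      congr 2; push_cast; ring

/-- The squared Euclidean length of an integer vector. -/
def intSq (ξ : ℤ × ℤ) : ℤ := ξ.1 ^ 2 + ξ.2 ^ 2

theorem intSq_neg (ξ : ℤ × ℤ) : intSq (-ξ) = intSq ξ := by simp [intSq]

theorem intSq_pos {ξ : ℤ × ℤ} (h : ξ ≠ 0) : 0 < intSq ξ := by
  unfold intSq
  by_contra hc
  apply h
  have h1 : ξ.1 ^ 2 = 0 := by nlinarith [sq_nonneg ξ.1, sq_nonneg ξ.2]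
  have h2 : ξ.2 ^ 2 = 0 := by nlinarith [sq_nonneg ξ.1, sq_nonneg ξ.2]
  exact Prod.ext (by simpa using h1) (by simpa using h2)

/-- Two lattice points are close relative to `lam` if their distance is below `lam ^ (1/3)`. -/
def IsClose (lam : ℝ) (μ ν : ℤ × ℤ) : Prop := ((intSq (μ - ν) : ℤ) : ℝ) ^ 3 < lam ^ 2

theorem IsClose.symm {lam : ℝ} {μ ν : ℤ × ℤ} (h : IsClose lam μ ν) : IsClose lam ν μ := by
  unfold IsClose at *
  rwa [← intSq_neg, neg_sub]

theorem four_mul_sq_le_intSq_mul {lam : ℝ} {μ ν ρ : ℤ × ℤ} (hμ : μ ∈ Elat lam)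
    (hν : ν ∈ Elat lam) (hρ : ρ ∈ Elat lam) (h1 : ν ≠ μ) (h2 : ρ ≠ μ) (h3 : ν ≠ ρ) :
    4 * lam ^ 2 ≤ (intSq (μ - ν) : ℝ) * intSq (μ - ρ) * intSq (ν - ρ) := by
  have eμ := sq_add_sq_of_mem_Elat hμ
  have eν := sq_add_sq_of_mem_Elat hν
  have eρ := sq_add_sq_of_mem_Elat hρ
  have p1 := intSq_pos (sub_ne_zero.mpr h1.symm)
  have p2 := intSq_pos (sub_ne_zero.mpr h2.symm)
  have p3 := intSq_pos (sub_ne_zero.mpr h3)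
  obtain ⟨a, b⟩ := μ
  obtain ⟨c, d⟩ := ν
  obtain ⟨e, f⟩ := ρ
  simp only [intSq, Prod.fst_sub, Prod.snd_sub] at *
  set D : ℤ := (c - a) * (f - b) - (d - b) * (e - a) with hD
  have hv : ((c : ℤ) - a) ^ 2 + (d - b) ^ 2 = - 2 * (a * (c - a) + b * (d - b)) := by
    have : ((a : ℝ)) ^ 2 + b ^ 2 = c ^ 2 + d ^ 2 := by rw [eμ, eν]
    have : a ^ 2 + b ^ 2 = c ^ 2 + d ^ 2 := by exact_mod_cast this
    linarith
  have hw : ((e : ℤ) - a) ^ 2 + (f - b) ^ 2 = - 2 * (a * (e - a) + b * (f - b)) := by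
    have : ((a : ℝ)) ^ 2 + b ^ 2 = e ^ 2 + f ^ 2 := by rw [eμ, eρ]
    have : a ^ 2 + b ^ 2 = e ^ 2 + f ^ 2 := by exact_mod_cast this
    linarith
  have key : 4 * D ^ 2 * (a ^ 2 + b ^ 2) =
      ((a - c) ^ 2 + (b - d) ^ 2) * ((a - e) ^ 2 + (b - f) ^ 2) * ((c - e) ^ 2 + (d - f) ^ 2) := by
    have k1 : 2 * (a * D) = ((e - a) ^ 2 + (f - b) ^ 2) * (d - b)
        - ((c - a) ^ 2 + (d - b) ^ 2) * (f - b) := by rw [hv, hw, hD]; ring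
    have k2 : 2 * (b * D) = ((c - a) ^ 2 + (d - b) ^ 2) * (e - a)
        - ((e - a) ^ 2 + (f - b) ^ 2) * (c - a) := by rw [hv, hw, hD]; ring
    calc 4 * D ^ 2 * (a ^ 2 + b ^ 2) = (2 * (a * D)) ^ 2 + (2 * (b * D)) ^ 2 := by ring
      _ = _ := by rw [k1, k2]; ring
  have hD0 : D ≠ 0 := by
    intro h
    rw [h] at key
    have := mul_pos (mul_pos p1 p2) p3
    rw [← key] at this
    simp at this
  have hD1 : 1 ≤ D ^ 2 := by
    have := sq_nonneg D
    have : D ^ 2 ≠ 0 := pow_ne_zero 2 hD0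
    omega
  have hZ : 4 * (a ^ 2 + b ^ 2) ≤ ((a - c) ^ 2 + (b - d) ^ 2) * ((a - e) ^ 2 + (b - f) ^ 2)
      * ((c - e) ^ 2 + (d - f) ^ 2) := by
    rw [← key]
    nlinarith [mul_nonneg (sub_nonneg.mpr hD1) (by positivity : 0 ≤ a ^ 2 + b ^ 2)]
  rw [← eμ]
  exact_mod_cast hZ

open Classical in
theorem card_filter_isClose_le_one {lam : ℝ} {μ : ℤ × ℤ} (hμ : μ ∈ Elat lam) :
    ((Elat lam).filter (fun ν => ν ≠ μ ∧ IsClose lam μ ν)).card ≤ 1 := by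
  rw [Finset.card_le_one]
  intro ν hν ρ hρ
  rw [Finset.mem_filter] at hν hρ
  by_contra hne
  have h := four_mul_sq_le_intSq_mul hμ hν.1 hρ.1 hν.2.1 hρ.2.1 hne
  have c1 : ((intSq (μ - ν) : ℤ) : ℝ) ^ 3 < lam ^ 2 := hν.2.2
  have c2 : ((intSq (μ - ρ) : ℤ) : ℝ) ^ 3 < lam ^ 2 := hρ.2.2
  have p1 : (0 : ℝ) < intSq (μ - ν) := by
    exact_mod_cast intSq_pos (sub_ne_zero.mpr hν.2.1.symm)
  have p2 : (0 : ℝ) < intSq (μ - ρ) := by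
    exact_mod_cast intSq_pos (sub_ne_zero.mpr hρ.2.1.symm)
  have h3 : (intSq (ν - ρ) : ℝ) ≤ 2 * intSq (μ - ν) + 2 * intSq (μ - ρ) := by
    have : intSq (ν - ρ) ≤ 2 * intSq (μ - ν) + 2 * intSq (μ - ρ) := by
      simp only [intSq, Prod.fst_sub, Prod.snd_sub]
      nlinarith [sq_nonneg ((μ.1 - ν.1) + (μ.1 - ρ.1)), sq_nonneg ((μ.2 - ν.2) + (μ.2 - ρ.2))]
    exact_mod_cast this
  set x : ℝ := ((intSq (μ - ν) : ℤ) : ℝ)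
  set y : ℝ := ((intSq (μ - ρ) : ℤ) : ℝ)
  have h4 : x * y * (intSq (ν - ρ) : ℝ) ≤ x * y * (2 * x + 2 * y) := by gcongr
  have h5 : x * y * (2 * x + 2 * y) ≤ 2 * (x ^ 3 + y ^ 3) := by
    nlinarith [mul_nonneg (add_pos p1 p2).le (sq_nonneg (x - y))]
  linarith

open Classical in
theorem sum_sum_mul_le_of_close {ι : Type*} (E : Finset ι) (R : ι → ι → Prop)
    (hR : ∀ μ ν, R μ ν → R ν μ)
    (hcard : ∀ μ ∈ E, (E.filter (fun ν => ν ≠ μ ∧ R μ ν)).card ≤ 1)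
    (b : ι → ℝ) (hb : ∀ μ, 0 ≤ b μ) (k : ι → ι → ℝ) {A B : ℝ} (hA : 0 ≤ A) (hB : 0 ≤ B)
    (hkA : ∀ μ ∈ E, ∀ ν ∈ E, μ ≠ ν → R μ ν → k μ ν ≤ A)
    (hkB : ∀ μ ∈ E, ∀ ν ∈ E, μ ≠ ν → ¬ R μ ν → k μ ν ≤ B) :
    ∑ μ ∈ E, ∑ ν ∈ E, (if μ = ν then 0 else b μ * b ν * k μ ν)
      ≤ (A + E.card * B) * ∑ μ ∈ E, b μ ^ 2 := by
  let κ : ι → ι → ℝ := fun μ ν => (if ν ≠ μ ∧ R μ ν then A else 0) + B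
  have hκ0 : ∀ μ ν, 0 ≤ κ μ ν := by
    intro μ ν; simp only [κ]; split_ifs <;> positivity
  have hκs : ∀ μ ν, κ μ ν = κ ν μ := by
    intro μ ν
    have : (ν ≠ μ ∧ R μ ν) ↔ (μ ≠ ν ∧ R ν μ) :=
      ⟨fun h => ⟨h.1.symm, hR _ _ h.2⟩, fun h => ⟨h.1.symm, hR _ _ h.2⟩⟩
    simp only [κ, this]
  have hrow : ∀ μ ∈ E, ∑ ν ∈ E, κ μ ν ≤ A + E.card * B := by
    intro μ hμ
    simp only [κ]
    rw [Finset.sum_add_distrib, ← Finset.sum_filter, Finset.sum_const, Finset.sum_const,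
      nsmul_eq_mul, nsmul_eq_mul]
    have : ((E.filter (fun ν => ν ≠ μ ∧ R μ ν)).card : ℝ) ≤ 1 := by exact_mod_cast hcard μ hμ
    nlinarith
  have hterm : ∀ μ ∈ E, ∀ ν ∈ E, (if μ = ν then 0 else b μ * b ν * k μ ν)
      ≤ (b μ ^ 2 * κ μ ν + b ν ^ 2 * κ ν μ) / 2 := by
    intro μ hμ ν hν
    rw [hκs ν μ]
    have h0 := hκ0 μ ν
    split_ifs with h
    · positivity
    · have hk : k μ ν ≤ κ μ ν := by
        simp only [κ]
        by_cases hr : R μ ν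
        · rw [if_pos ⟨fun e => h e.symm, hr⟩]; linarith [hkA μ hμ ν hν h hr]
        · rw [if_neg (fun e => hr e.2)]; linarith [hkB μ hμ ν hν h hr]
      have h2 : b μ * b ν * k μ ν ≤ b μ * b ν * κ μ ν := by
        have := mul_nonneg (hb μ) (hb ν); gcongr
      nlinarith [mul_nonneg h0 (sq_nonneg (b μ - b ν))]
  calc _ ≤ ∑ μ ∈ E, ∑ ν ∈ E, (b μ ^ 2 * κ μ ν + b ν ^ 2 * κ ν μ) / 2 :=
        Finset.sum_le_sum fun μ hμ => Finset.sum_le_sum fun ν hν => hterm μ hμ ν hν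
    _ = ∑ μ ∈ E, ∑ ν ∈ E, b μ ^ 2 * κ μ ν := by
        simp_rw [← Finset.sum_div, Finset.sum_add_distrib]
        rw [Finset.sum_comm (f := fun μ ν => b ν ^ 2 * κ ν μ)]
        ring
    _ = ∑ μ ∈ E, b μ ^ 2 * ∑ ν ∈ E, κ μ ν := by simp_rw [Finset.mul_sum]
    _ ≤ ∑ μ ∈ E, b μ ^ 2 * (A + E.card * B) :=
        Finset.sum_le_sum fun μ hμ => mul_le_mul_of_nonneg_left (hrow μ hμ) (sq_nonneg _)
    _ = _ := by rw [← Finset.sum_mul, mul_comm]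

open Classical in
theorem abs_integral_norm_sq_sub_diag_le {ι : Type*} (E : Finset ι) (R : ι → ι → Prop)
    (hR : ∀ μ ν, R μ ν → R ν μ)
    (hcard : ∀ μ ∈ E, (E.filter (fun ν => ν ≠ μ ∧ R μ ν)).card ≤ 1)
    (a : ι → ℂ) (g : ι → ℝ → ℂ) (hg : ∀ μ, Continuous (g μ)) (L : ℝ) {A B : ℝ}
    (hA : 0 ≤ A) (hB : 0 ≤ B)
    (hkA : ∀ μ ∈ E, ∀ ν ∈ E, μ ≠ ν → R μ ν →
      ‖∫ t in (0:ℝ)..L, g μ t * starRingEnd ℂ (g ν t)‖ ≤ A)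
    (hkB : ∀ μ ∈ E, ∀ ν ∈ E, μ ≠ ν → ¬ R μ ν →
      ‖∫ t in (0:ℝ)..L, g μ t * starRingEnd ℂ (g ν t)‖ ≤ B) :
    |(∫ t in (0:ℝ)..L, ‖∑ μ ∈ E, a μ * g μ t‖ ^ 2) -
      ∑ μ ∈ E, ‖a μ‖ ^ 2 * ∫ t in (0:ℝ)..L, ‖g μ t‖ ^ 2|
      ≤ (A + E.card * B) * ∑ μ ∈ E, ‖a μ‖ ^ 2 := by
  set J : ι → ι → ℂ := fun μ ν => ∫ t in (0:ℝ)..L, g μ t * starRingEnd ℂ (g ν t) with hJ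
  have hcont : ∀ μ ν, Continuous (fun t => g μ t * starRingEnd ℂ (g ν t)) := fun μ ν =>
    (hg μ).mul (Complex.continuous_conj.comp (hg ν))
  have h1 : ((∫ t in (0:ℝ)..L, ‖∑ μ ∈ E, a μ * g μ t‖ ^ 2 : ℝ) : ℂ)
      = ∑ μ ∈ E, ∑ ν ∈ E, a μ * starRingEnd ℂ (a ν) * J μ ν := by
    rw [← intervalIntegral.integral_ofReal]
    have : ∀ t : ℝ, ((‖∑ μ ∈ E, a μ * g μ t‖ ^ 2 : ℝ) : ℂ) =
        ∑ μ ∈ E, ∑ ν ∈ E, a μ * starRingEnd ℂ (a ν) * (g μ t * starRingEnd ℂ (g ν t)) := by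
      intro t
      rw [Complex.ofReal_pow, ← Complex.mul_conj', map_sum, Finset.sum_mul_sum]
      refine Finset.sum_congr rfl fun μ _ => Finset.sum_congr rfl fun ν _ => ?_
      rw [map_mul]; ring
    simp_rw [this]
    rw [intervalIntegral.integral_finsetSum]
    · refine Finset.sum_congr rfl fun μ _ => ?_
      rw [intervalIntegral.integral_finsetSum]
      · refine Finset.sum_congr rfl fun ν _ => ?_
        rw [intervalIntegral.integral_const_mul]
      · intro ν _
        exact ((hcont μ ν).const_mul _).intervalIntegrable _ _
    · intro μ _
      exact (continuous_finsetSum _ fun ν _ => (hcont μ ν).const_mul _).intervalIntegrable _ _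
  have h2 : ((∑ μ ∈ E, ‖a μ‖ ^ 2 * ∫ t in (0:ℝ)..L, ‖g μ t‖ ^ 2 : ℝ) : ℂ)
      = ∑ μ ∈ E, ∑ ν ∈ E, if μ = ν then a μ * starRingEnd ℂ (a ν) * J μ ν else 0 := by
    rw [Complex.ofReal_sum]
    refine Finset.sum_congr rfl fun μ hμ => ?_
    rw [Finset.sum_ite_eq, if_pos hμ, Complex.ofReal_mul, Complex.mul_conj', hJ,
      ← intervalIntegral.integral_ofReal]
    push_cast
    congr 1
    refine intervalIntegral.integral_congr fun t _ => ?_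
    rw [Complex.mul_conj']
  rw [← Real.norm_eq_abs, ← Complex.norm_real, Complex.ofReal_sub, h1, h2,
    ← Finset.sum_sub_distrib]
  calc ‖_‖ ≤ ∑ μ ∈ E, ∑ ν ∈ E, (if μ = ν then 0 else ‖a μ‖ * ‖a ν‖ * ‖J μ ν‖) := by
        refine (norm_sum_le _ _).trans (Finset.sum_le_sum fun μ _ => ?_)
        rw [← Finset.sum_sub_distrib]
        refine (norm_sum_le _ _).trans (Finset.sum_le_sum fun ν _ => ?_)
        split_ifs
        · simp
        · simp
    _ ≤ _ := sum_sum_mul_le_of_close E R hR hcard (fun μ => ‖a μ‖) (fun _ => norm_nonneg _)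
        (fun μ ν => ‖J μ ν‖) hA hB hkA hkB

/-- A phase function `Φ` with derivatives `x`, `x1`, `x2` which is uniformly nondegenerate
on `[0, L]`. -/
structure IsPhase (L A B : ℝ) (Φ x x1 x2 : ℝ → ℝ) : Prop where
  deriv0 : ∀ t, HasDerivAt Φ (x t) t
  deriv1 : ∀ t, HasDerivAt x (x1 t) t
  deriv2 : ∀ t, HasDerivAt x1 (x2 t) t
  cont : Continuous x2
  nondeg : ∀ t ∈ Set.Icc (0:ℝ) L, 1 ≤ x t ^ 2 + A * x1 t ^ 2
  bound1 : ∀ t ∈ Set.Icc (0:ℝ) L, |x1 t| ≤ B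
  bound2 : ∀ t ∈ Set.Icc (0:ℝ) L, |x2 t| ≤ B

/-- The regularization `x / (x² + θ²)` of `1 / x`. -/
def regInv (θ x : ℝ) : ℝ := x / (x ^ 2 + θ ^ 2)

/-- The derivative of `regInv θ`. -/
def regInvDeriv (θ x : ℝ) : ℝ := (θ ^ 2 - x ^ 2) / (x ^ 2 + θ ^ 2) ^ 2

/-- The weight `θ² / (x² + θ²)` concentrated on `|x| ≲ θ`. -/
def nearWeight (θ x : ℝ) : ℝ := θ ^ 2 / (x ^ 2 + θ ^ 2)

/-- The derivative of `nearWeight θ`. -/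
def nearWeightDeriv (θ x : ℝ) : ℝ := - (2 * x * θ ^ 2) / (x ^ 2 + θ ^ 2) ^ 2

theorem hasDerivAt_regInv {θ : ℝ} (hθ : 0 < θ) (x : ℝ) :
    HasDerivAt (regInv θ) (regInvDeriv θ x) x := by
  have h := (hasDerivAt_id' x).div ((hasDerivAt_pow 2 x).add_const (θ ^ 2))
    (by positivity : x ^ 2 + θ ^ 2 ≠ 0)
  refine HasDerivAt.congr_deriv h ?_
  unfold regInvDeriv
  congr 1
  push_cast
  ring

theorem hasDerivAt_nearWeight {θ : ℝ} (hθ : 0 < θ) (x : ℝ) :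
    HasDerivAt (nearWeight θ) (nearWeightDeriv θ x) x := by
  have h := (hasDerivAt_const x (θ ^ 2)).div ((hasDerivAt_pow 2 x).add_const (θ ^ 2))
    (by positivity : x ^ 2 + θ ^ 2 ≠ 0)
  refine HasDerivAt.congr_deriv h ?_
  unfold nearWeightDeriv
  congr 1
  push_cast
  ring

theorem abs_regInv_le {θ : ℝ} (hθ : 0 < θ) (x : ℝ) : |regInv θ x| ≤ 1 / θ := by
  have hp : 0 < x ^ 2 + θ ^ 2 := by positivity
  rw [regInv, abs_div, abs_of_pos hp, div_le_div_iff₀ hp hθ]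
  nlinarith [sq_nonneg (|x| - θ), sq_abs x, abs_nonneg x]

theorem abs_regInvDeriv_le {θ : ℝ} (hθ : 0 < θ) (x : ℝ) : |regInvDeriv θ x| ≤ 1 / θ ^ 2 := by
  have hp : 0 < x ^ 2 + θ ^ 2 := by positivity
  rw [regInvDeriv, abs_div, abs_of_pos (pow_pos hp 2),
    div_le_div_iff₀ (pow_pos hp 2) (pow_pos hθ 2)]
  have : |θ ^ 2 - x ^ 2| ≤ x ^ 2 + θ ^ 2 := by
    rw [abs_le]; constructor <;> nlinarith [sq_nonneg x, sq_nonneg θ]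
  nlinarith [sq_nonneg x, sq_nonneg θ, mul_nonneg hp.le (sq_nonneg x),
    mul_le_mul_of_nonneg_right this (sq_nonneg θ)]

theorem nearWeight_nonneg (θ x : ℝ) : 0 ≤ nearWeight θ x := by
  unfold nearWeight; positivity

theorem nearWeight_le_one (θ x : ℝ) : nearWeight θ x ≤ 1 := by
  unfold nearWeight
  exact div_le_one_of_le₀ (by nlinarith [sq_nonneg x]) (by positivity)

theorem abs_nearWeightDeriv_le {θ : ℝ} (hθ : 0 < θ) (x : ℝ) :
    |nearWeightDeriv θ x| ≤ 1 / θ := by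
  have hp : 0 < x ^ 2 + θ ^ 2 := by positivity
  have h2 : |2 * x * θ ^ 2| = 2 * |x| * θ ^ 2 := by
    rw [abs_mul, abs_mul, abs_of_pos (by norm_num : (0:ℝ) < 2),
      abs_of_pos (by positivity : 0 < θ ^ 2)]
  rw [nearWeightDeriv, abs_div, abs_neg, abs_of_pos (pow_pos hp 2), h2,
    div_le_div_iff₀ (pow_pos hp 2) hθ, ← sq_abs x]
  have h3 : 2 * |x| * θ ≤ |x| ^ 2 + θ ^ 2 := by nlinarith [sq_nonneg (|x| - θ)]
  have h4 : θ ^ 2 ≤ |x| ^ 2 + θ ^ 2 := by nlinarith [sq_nonneg (|x|)]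
  nlinarith [mul_le_mul h3 h4 (by positivity) (by positivity)]

theorem continuous_regInv {θ : ℝ} (hθ : 0 < θ) : Continuous (regInv θ) := by
  unfold regInv
  exact continuous_id.div (by fun_prop) (fun x => by positivity)

theorem continuous_regInvDeriv {θ : ℝ} (hθ : 0 < θ) : Continuous (regInvDeriv θ) := by
  unfold regInvDeriv
  exact Continuous.div (by fun_prop) (by fun_prop) (fun x => by positivity)

theorem continuous_nearWeight {θ : ℝ} (hθ : 0 < θ) : Continuous (nearWeight θ) := by
  unfold nearWeight
  exact Continuous.div (by fun_prop) (by fun_prop) (fun x => by positivity)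

theorem continuous_nearWeightDeriv {θ : ℝ} (hθ : 0 < θ) : Continuous (nearWeightDeriv θ) := by
  unfold nearWeightDeriv
  exact Continuous.div (by fun_prop) (by fun_prop) (fun x => by positivity)

namespace IsPhase

variable {L A B : ℝ} {Φ x x1 x2 : ℝ → ℝ}

theorem continuous_phase (h : IsPhase L A B Φ x x1 x2) : Continuous Φ :=
  continuous_iff_continuousAt.mpr fun t => (h.deriv0 t).continuousAt

theorem continuous_deriv (h : IsPhase L A B Φ x x1 x2) : Continuous x :=
  continuous_iff_continuousAt.mpr fun t => (h.deriv1 t).continuousAt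

theorem continuous_deriv2 (h : IsPhase L A B Φ x x1 x2) : Continuous x1 :=
  continuous_iff_continuousAt.mpr fun t => (h.deriv2 t).continuousAt

theorem integral_nearWeight_le (h : IsPhase L A B Φ x x1 x2) (hL : 0 ≤ L) (hA : 0 ≤ A)
    {θ : ℝ} (hθ : 0 < θ) (hθ1 : θ ≤ 1) :
    ∫ t in (0:ℝ)..L, nearWeight θ (x t) ≤ (L + A * (π / 2 * (2 * B + L * B))) * θ := by
  have cx := h.continuous_deriv
  have cx1 := h.continuous_deriv2
  have cx2 := h.cont
  have hpos : ∀ t, 0 < x t ^ 2 + θ ^ 2 := fun t => by positivity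
  have carc : Continuous (fun t => Real.arctan (x t / θ)) :=
    Real.continuous_arctan.comp (cx.div_const θ)
  have cu : Continuous (fun t => θ * x1 t ^ 2 / (x t ^ 2 + θ ^ 2)) :=
    Continuous.div (by fun_prop) (by fun_prop) (fun t => (hpos t).ne')
  have cv : Continuous (fun t => Real.arctan (x t / θ) * x2 t) := carc.mul cx2
  have hd : ∀ t, HasDerivAt (fun t => Real.arctan (x t / θ) * x1 t)
      (θ * x1 t ^ 2 / (x t ^ 2 + θ ^ 2) + Real.arctan (x t / θ) * x2 t) t := by
    intro t
    have := (((h.deriv1 t).div_const θ).arctan).mul (h.deriv2 t)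
    refine HasDerivAt.congr_deriv this ?_
    have := hpos t
    field_simp
    ring
  have hintegral :
      ∫ t in (0:ℝ)..L, (θ * x1 t ^ 2 / (x t ^ 2 + θ ^ 2) + Real.arctan (x t / θ) * x2 t)
      = Real.arctan (x L / θ) * x1 L - Real.arctan (x 0 / θ) * x1 0 :=
    intervalIntegral.integral_eq_sub_of_hasDerivAt (fun t _ => hd t)
      ((cu.add cv).intervalIntegrable _ _)
  rw [intervalIntegral.integral_add (cu.intervalIntegrable _ _)
    (cv.intervalIntegrable _ _)] at hintegral
  have harc : ∀ y, |Real.arctan y| ≤ π / 2 := fun y =>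
    abs_le.mpr ⟨(Real.neg_pi_div_two_lt_arctan y).le, (Real.arctan_lt_pi_div_two y).le⟩
  have hB : 0 ≤ B := (abs_nonneg _).trans (h.bound1 0 ⟨le_rfl, hL⟩)
  have hprod : ∀ y z, |z| ≤ B → |Real.arctan y * z| ≤ π / 2 * B := fun y z hz => by
    rw [abs_mul]; exact mul_le_mul (harc y) hz (abs_nonneg _) (by positivity)
  have h2 : |∫ t in (0:ℝ)..L, Real.arctan (x t / θ) * x2 t| ≤ π / 2 * B * L := by
    have := intervalIntegral.norm_integral_le_of_norm_le_const (a := (0:ℝ)) (b := L)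
      (f := fun t => Real.arctan (x t / θ) * x2 t) (C := π / 2 * B) (fun t ht => by
        rw [Set.uIoc_of_le hL] at ht
        exact hprod _ _ (h.bound2 t ⟨ht.1.le, ht.2⟩))
    rwa [sub_zero, abs_of_nonneg hL] at this
  have h3 : ∫ t in (0:ℝ)..L, θ * x1 t ^ 2 / (x t ^ 2 + θ ^ 2) ≤ π / 2 * (2 * B + L * B) := by
    have e1 := abs_le.mp (hprod (x L / θ) (x1 L) (h.bound1 L ⟨hL, le_rfl⟩))
    have e2 := abs_le.mp (hprod (x 0 / θ) (x1 0) (h.bound1 0 ⟨le_rfl, hL⟩))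
    have e3 := abs_le.mp h2
    linarith [e1.2, e2.1, e3.1]
  calc ∫ t in (0:ℝ)..L, nearWeight θ (x t)
      ≤ ∫ t in (0:ℝ)..L, (θ + A * θ * (θ * x1 t ^ 2 / (x t ^ 2 + θ ^ 2))) := by
        refine intervalIntegral.integral_mono_on hL
          (((continuous_nearWeight hθ).comp cx).intervalIntegrable _ _)
          ((continuous_const.add (cu.const_mul (A * θ))).intervalIntegrable _ _) fun t ht => ?_
        have hp := hpos t
        have hn := h.nondeg t ht
        unfold nearWeight
        rw [show θ + A * θ * (θ * x1 t ^ 2 / (x t ^ 2 + θ ^ 2)) =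
          (θ * (x t ^ 2 + θ ^ 2) + A * θ * (θ * x1 t ^ 2)) / (x t ^ 2 + θ ^ 2) by field_simp]
        refine div_le_div_of_nonneg_right ?_ hp.le
        have k1 : θ ^ 2 * 1 ≤ θ ^ 2 * (x t ^ 2 + A * x1 t ^ 2) := by gcongr
        have k2 : θ ^ 2 * x t ^ 2 ≤ θ * x t ^ 2 := by
          have : θ ^ 2 ≤ θ := by nlinarith
          gcongr
        have k3 : 0 ≤ θ * θ ^ 2 := by positivity
        nlinarith
    _ = L * θ + A * θ * ∫ t in (0:ℝ)..L, (θ * x1 t ^ 2 / (x t ^ 2 + θ ^ 2)) := by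
        rw [intervalIntegral.integral_add (continuous_const.intervalIntegrable _ _)
          ((cu.const_mul (A * θ)).intervalIntegrable _ _), intervalIntegral.integral_const_mul]
        simp
    _ ≤ L * θ + A * θ * (π / 2 * (2 * B + L * B)) := by gcongr
    _ = _ := by ring

theorem hasDerivAt_exp (h : IsPhase L A B Φ x x1 x2) (r t : ℝ) :
    HasDerivAt (fun t => Complex.exp (Complex.I * ((r * Φ t : ℝ) : ℂ)))
      (Complex.I * ((r * x t : ℝ) : ℂ) * Complex.exp (Complex.I * ((r * Φ t : ℝ) : ℂ))) t := by
  have := ((((h.deriv0 t).const_mul r).ofReal_comp).const_mul Complex.I).cexp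
  convert this using 1
  ring

theorem continuous_exp (h : IsPhase L A B Φ x x1 x2) (r : ℝ) :
    Continuous (fun t => Complex.exp (Complex.I * ((r * Φ t : ℝ) : ℂ))) :=
  continuous_iff_continuousAt.mpr fun t => (h.hasDerivAt_exp r t).continuousAt

theorem norm_integral_mul_exp_le (h : IsPhase L A B Φ x x1 x2) (hL : 0 ≤ L) (hA : 0 ≤ A)
    {θ r : ℝ} (hθ : 0 < θ) (hθ1 : θ ≤ 1) (hr : 1 ≤ r * θ ^ 3)
    {W W1 : ℝ → ℝ} (hW : ∀ t, HasDerivAt W (W1 t) t) (cW1 : Continuous W1) {D : ℝ} (hD : 1 ≤ D)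
    (bW : ∀ t ∈ Set.Icc (0:ℝ) L, |W t| ≤ 1) (bW1 : ∀ t ∈ Set.Icc (0:ℝ) L, |W1 t| ≤ D) :
    ‖∫ t in (0:ℝ)..L, (W t : ℂ) * Complex.exp (Complex.I * ((r * Φ t : ℝ) : ℂ))‖
      ≤ (L + A * (π / 2 * (2 * B + L * B)) + 2 + L + L * B) * D * θ := by
  have cx := h.continuous_deriv
  have cx1 := h.continuous_deriv2
  have cW : Continuous W := continuous_iff_continuousAt.mpr fun t => (hW t).continuousAt
  have hr0 : 0 < r := by
    by_contra hc
    nlinarith [pow_pos hθ 3, mul_nonneg (sub_nonneg.mpr (not_lt.mp hc)) (pow_pos hθ 3).le]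
  have hB : 0 ≤ B := (abs_nonneg _).trans (h.bound1 0 ⟨le_rfl, hL⟩)
  set e : ℝ → ℂ := fun t => Complex.exp (Complex.I * ((r * Φ t : ℝ) : ℂ)) with he
  have ce : Continuous e := h.continuous_exp r
  have ne : ∀ t, ‖e t‖ = 1 := fun t => by
    rw [he]; simp only; rw [mul_comm, Complex.norm_exp_ofReal_mul_I]
  set g : ℝ → ℝ := fun t => W t * regInv θ (x t) with hg
  set g1 : ℝ → ℝ := fun t => W1 t * regInv θ (x t) + W t * (regInvDeriv θ (x t) * x1 t) with hg1
  have dg : ∀ t, HasDerivAt g (g1 t) t := fun t =>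
    (hW t).mul ((hasDerivAt_regInv hθ (x t)).comp t (h.deriv1 t))
  have cg1 : Continuous g1 := (cW1.mul ((continuous_regInv hθ).comp cx)).add
    (cW.mul (((continuous_regInvDeriv hθ).comp cx).mul cx1))
  have cg : Continuous g := cW.mul ((continuous_regInv hθ).comp cx)
  have bg : ∀ t ∈ Set.Icc (0:ℝ) L, |g t| ≤ 1 / θ := fun t ht => by
    rw [hg]; simp only; rw [abs_mul, ← one_mul (1 / θ)]
    exact mul_le_mul (bW t ht) (abs_regInv_le hθ _) (abs_nonneg _) zero_le_one
  have hθi : 1 / θ ≤ 1 / θ ^ 2 := by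
    apply one_div_le_one_div_of_le (by positivity); nlinarith
  have bg1 : ∀ t ∈ Set.Icc (0:ℝ) L, |g1 t| ≤ D * (1 + B) * (1 / θ ^ 2) := fun t ht => by
    have k1 : |W1 t * regInv θ (x t)| ≤ D * (1 / θ ^ 2) := by
      rw [abs_mul]
      exact mul_le_mul (bW1 t ht) ((abs_regInv_le hθ _).trans hθi) (abs_nonneg _) (by linarith)
    have k2 : |W t * (regInvDeriv θ (x t) * x1 t)| ≤ D * (1 / θ ^ 2 * B) := by
      rw [abs_mul, abs_mul]
      refine mul_le_mul ((bW t ht).trans hD) ?_ (by positivity) (by linarith)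
      exact mul_le_mul (abs_regInvDeriv_le hθ _) (h.bound1 t ht) (abs_nonneg _) (by positivity)
    calc |g1 t| ≤ _ := abs_add_le _ _
      _ ≤ D * (1 / θ ^ 2) + D * (1 / θ ^ 2 * B) := add_le_add k1 k2
      _ = _ := by ring
  have dge : ∀ t, HasDerivAt (fun t => (g t : ℂ) * e t)
      ((g1 t : ℂ) * e t + (g t : ℂ) * (Complex.I * ((r * x t : ℝ) : ℂ) * e t)) t := fun t =>
    ((dg t).ofReal_comp).mul (h.hasDerivAt_exp r t)
  have cge1 : Continuous (fun t => (g1 t : ℂ) * e t) := (Complex.continuous_ofReal.comp cg1).mul ce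
  have cge2 : Continuous (fun t => (g t : ℂ) * (Complex.I * ((r * x t : ℝ) : ℂ) * e t)) :=
    (Complex.continuous_ofReal.comp cg).mul
      ((continuous_const.mul (Complex.continuous_ofReal.comp (cx.const_mul r))).mul ce)
  have hintegral := intervalIntegral.integral_eq_sub_of_hasDerivAt (a := (0:ℝ)) (b := L)
    (fun t _ => dge t) ((cge1.add cge2).intervalIntegrable _ _)
  rw [intervalIntegral.integral_add (cge1.intervalIntegrable _ _)
    (cge2.intervalIntegrable _ _)] at hintegral
  have cnw : Continuous (fun t => (W t : ℂ) * (nearWeight θ (x t) : ℂ) * e t) :=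
    ((Complex.continuous_ofReal.comp cW).mul
      (Complex.continuous_ofReal.comp ((continuous_nearWeight hθ).comp cx))).mul ce
  have hsplit : ∫ t in (0:ℝ)..L, (W t : ℂ) * e t =
      (∫ t in (0:ℝ)..L, (W t : ℂ) * (nearWeight θ (x t) : ℂ) * e t) +
      (1 / (Complex.I * r)) *
        ∫ t in (0:ℝ)..L, (g t : ℂ) * (Complex.I * ((r * x t : ℝ) : ℂ) * e t) := by
    rw [← intervalIntegral.integral_const_mul, ← intervalIntegral.integral_add
      (cnw.intervalIntegrable _ _) ((cge2.const_mul _).intervalIntegrable _ _)]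
    refine intervalIntegral.integral_congr fun t _ => ?_
    have hr' : (r : ℂ) ≠ 0 := by exact_mod_cast hr0.ne'
    have hone : (nearWeight θ (x t) : ℂ) + (regInv θ (x t) : ℂ) * (x t : ℂ) = 1 := by
      have : nearWeight θ (x t) + regInv θ (x t) * x t = 1 := by
        have : 0 < x t ^ 2 + θ ^ 2 := by positivity
        unfold nearWeight regInv
        field_simp
        ring
      exact_mod_cast this
    simp only [hg]
    push_cast
    field_simp
    linear_combination (-(W t : ℂ) * e t) * hone
  have n1 : ‖∫ t in (0:ℝ)..L, (W t : ℂ) * (nearWeight θ (x t) : ℂ) * e t‖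
      ≤ (L + A * (π / 2 * (2 * B + L * B))) * θ := by
    refine le_trans ?_ (h.integral_nearWeight_le hL hA hθ hθ1)
    refine intervalIntegral.norm_integral_le_of_norm_le hL
      (Filter.Eventually.of_forall fun t ht => ?_)
      (((continuous_nearWeight hθ).comp cx).intervalIntegrable _ _)
    rw [norm_mul, norm_mul, ne, mul_one, Complex.norm_real, Complex.norm_real, Real.norm_eq_abs,
      Real.norm_eq_abs, abs_of_nonneg (nearWeight_nonneg _ _)]
    exact mul_le_of_le_one_left (nearWeight_nonneg _ _) (bW t ⟨ht.1.le, ht.2⟩)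
  have n2 : ‖∫ t in (0:ℝ)..L, (g1 t : ℂ) * e t‖ ≤ D * (1 + B) * (1 / θ ^ 2) * L := by
    have := intervalIntegral.norm_integral_le_of_norm_le_const (a := (0:ℝ)) (b := L)
      (f := fun t => (g1 t : ℂ) * e t) (C := D * (1 + B) * (1 / θ ^ 2)) (fun t ht => by
        rw [Set.uIoc_of_le hL] at ht
        rw [norm_mul, ne, mul_one, Complex.norm_real]
        exact bg1 t ⟨ht.1.le, ht.2⟩)
    rwa [sub_zero, abs_of_nonneg hL] at this
  have nend : ∀ t ∈ Set.Icc (0:ℝ) L, ‖(g t : ℂ) * e t‖ ≤ 1 / θ ^ 2 := fun t ht => by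
    rw [norm_mul, ne, mul_one, Complex.norm_real]
    exact (bg t ht).trans hθi
  have n3 : ‖∫ t in (0:ℝ)..L, (g t : ℂ) * (Complex.I * ((r * x t : ℝ) : ℂ) * e t)‖
      ≤ (2 + D * (1 + B) * L) * (1 / θ ^ 2) := by
    rw [eq_sub_of_add_eq' hintegral]
    have := norm_sub_le ((g L : ℂ) * e L - (g 0 : ℂ) * e 0) (∫ t in (0:ℝ)..L, (g1 t : ℂ) * e t)
    have := norm_sub_le ((g L : ℂ) * e L) ((g 0 : ℂ) * e 0)
    have := nend L ⟨hL, le_rfl⟩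
    have := nend 0 ⟨le_rfl, hL⟩
    linarith
  have hrθ : 1 / r * (1 / θ ^ 2) ≤ θ := by
    rw [div_mul_div_comm, one_mul, div_le_iff₀ (by positivity)]
    linarith
  calc ‖∫ t in (0:ℝ)..L, (W t : ℂ) * e t‖
      ≤ (L + A * (π / 2 * (2 * B + L * B))) * θ +
        1 / r * ((2 + D * (1 + B) * L) * (1 / θ ^ 2)) := by
        rw [hsplit]
        refine (norm_add_le _ _).trans (add_le_add n1 ?_)
        rw [norm_mul, norm_div, norm_mul, Complex.norm_I, one_mul, Complex.norm_real, norm_one,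
          Real.norm_eq_abs, abs_of_pos hr0]
        gcongr
    _ = (L + A * (π / 2 * (2 * B + L * B))) * θ +
        (2 + D * (1 + B) * L) * (1 / r * (1 / θ ^ 2)) := by
        ring
    _ ≤ (L + A * (π / 2 * (2 * B + L * B))) * θ + (2 + D * (1 + B) * L) * θ := by gcongr
    _ ≤ (L + A * (π / 2 * (2 * B + L * B))) * D * θ + (2 * D + D * (1 + B) * L) * θ := by
        have : 0 ≤ L + A * (π / 2 * (2 * B + L * B)) := by positivity
        gcongr
        · exact le_mul_of_one_le_right this hD
        · linarith
    _ = _ := by ring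

theorem norm_integral_exp_lt (h : IsPhase L A B Φ x x1 x2) (hL : 0 < L) {r : ℝ} (hr : 0 < r) :
    ‖∫ t in (0:ℝ)..L, Complex.exp (Complex.I * ((r * Φ t : ℝ) : ℂ))‖ < L := by
  set e : ℝ → ℂ := fun t => Complex.exp (Complex.I * ((r * Φ t : ℝ) : ℂ)) with he
  have ce : Continuous e := h.continuous_exp r
  have ne : ∀ t, ‖e t‖ = 1 := fun t => by
    rw [he]; simp only; rw [mul_comm, Complex.norm_exp_ofReal_mul_I]
  rcases ae_eq_const_or_norm_setIntegral_lt_of_norm_le_const (μ := volume) (t := Set.Ioc (0:ℝ) L)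
    (f := e) (C := 1) (by simp) (Filter.Eventually.of_forall fun t => (ne t).le) with hc | hlt
  · exfalso
    have hc' : e =ᵐ[volume.restrict (Set.Ioo (0:ℝ) L)]
        Function.const ℝ (⨍ t in Set.Ioc (0:ℝ) L, e t) :=
      ae_mono (Measure.restrict_mono Set.Ioo_subset_Ioc_self le_rfl) hc
    have hEq := Measure.eqOn_of_ae_eq hc' ce.continuousOn continuous_const.continuousOn
      (by rw [interior_Ioo]; exact subset_closure)
    have hx0 : ∀ t ∈ Set.Ioo (0:ℝ) L, x t = 0 := by
      intro t ht
      have h1 : HasDerivAt e 0 t := by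
        refine (hasDerivAt_const t (⨍ t in Set.Ioc (0:ℝ) L, e t)).congr_of_eventuallyEq ?_
        filter_upwards [isOpen_Ioo.mem_nhds ht] with s hs
        exact hEq hs
      have h2 := (h.hasDerivAt_exp r t).unique h1
      simp only [mul_eq_zero, Complex.I_ne_zero, Complex.exp_ne_zero, or_false, false_or,
        Complex.ofReal_eq_zero] at h2
      exact h2.resolve_left hr.ne'
    have hm : L / 2 ∈ Set.Ioo (0:ℝ) L := ⟨by linarith, by linarith⟩
    have h1 : HasDerivAt x 0 (L / 2) := by
      refine (hasDerivAt_const (L / 2) (0:ℝ)).congr_of_eventuallyEq ?_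
      filter_upwards [isOpen_Ioo.mem_nhds hm] with s hs
      exact hx0 s hs
    have h2 := (h.deriv1 (L / 2)).unique h1
    have h3 := h.nondeg (L / 2) ⟨hm.1.le, hm.2.le⟩
    rw [h2, hx0 _ hm] at h3
    norm_num at h3
  · rw [intervalIntegral.integral_of_le hL.le]
    refine lt_of_lt_of_eq hlt ?_
    simp [hL.le]

end IsPhase

theorem exists_mul_le_integral {h : ℝ → ℝ} (ch : Continuous h) {a b : ℝ} (hab : a ≤ b) :
    ∃ s ∈ Set.Icc a b, h s * (b - a) ≤ ∫ t in a..b, h t := by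
  obtain ⟨s, hs, hmin⟩ := isCompact_Icc.exists_isMinOn (Set.nonempty_Icc.mpr hab) ch.continuousOn
  refine ⟨s, hs, ?_⟩
  have : ∫ _ in a..b, h s ≤ ∫ t in a..b, h t :=
    intervalIntegral.integral_mono_on hab (continuous_const.intervalIntegrable _ _)
      (ch.intervalIntegrable _ _) fun t ht => hmin ht
  rw [intervalIntegral.integral_const, smul_eq_mul] at this
  linarith

theorem integral_abs_le_of_ne_zero {f : ℝ → ℝ} (cf : Continuous f) {G E : ℝ → ℂ}
    (hG : ∀ t, HasDerivAt G ((f t : ℂ) - E t) t) (cE : Continuous E) {a b : ℝ} (hab : a ≤ b)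
    (hne : ∀ t ∈ Set.Icc a b, f t ≠ 0) :
    ∫ t in a..b, |f t| ≤ ‖G a‖ + ‖G b‖ + ∫ t in a..b, ‖E t‖ := by
  have hsign : ∫ t in a..b, |f t| = |∫ t in a..b, f t| := by
    rcases lt_or_gt_of_ne (hne a ⟨le_rfl, hab⟩) with h | h
    · have hneg : ∀ t ∈ Set.Icc a b, f t ≤ 0 := by
        intro t ht
        by_contra hc
        obtain ⟨s, hs, hs0⟩ := intermediate_value_Icc ht.1 cf.continuousOn
          (⟨h.le, (not_le.mp hc).le⟩ : (0:ℝ) ∈ Set.Icc (f a) (f t))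
        exact hne s ⟨hs.1, hs.2.trans ht.2⟩ hs0
      have e : ∫ t in a..b, |f t| = ∫ t in a..b, - f t :=
        intervalIntegral.integral_congr fun t ht => by
          rw [Set.uIcc_of_le hab] at ht
          exact abs_of_nonpos (hneg t ht)
      have h0 : 0 ≤ ∫ t in a..b, |f t| :=
        intervalIntegral.integral_nonneg hab fun t _ => abs_nonneg _
      rw [intervalIntegral.integral_neg] at e
      rw [abs_of_nonpos (by linarith), e]
    · have hpos : ∀ t ∈ Set.Icc a b, 0 ≤ f t := by
        intro t ht
        by_contra hc
        obtain ⟨s, hs, hs0⟩ := intermediate_value_Icc' ht.1 cf.continuousOn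
          (⟨(not_le.mp hc).le, h.le⟩ : (0:ℝ) ∈ Set.Icc (f t) (f a))
        exact hne s ⟨hs.1, hs.2.trans ht.2⟩ hs0
      have e : ∫ t in a..b, |f t| = ∫ t in a..b, f t :=
        intervalIntegral.integral_congr fun t ht => by
          rw [Set.uIcc_of_le hab] at ht
          exact abs_of_nonneg (hpos t ht)
      rw [e, abs_of_nonneg (intervalIntegral.integral_nonneg hab hpos)]
  have cfc : Continuous (fun t => (f t : ℂ)) := Complex.continuous_ofReal.comp cf
  have hintegral := intervalIntegral.integral_eq_sub_of_hasDerivAt (a := a) (b := b)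
    (fun t _ => hG t) ((cfc.sub cE).intervalIntegrable _ _)
  rw [intervalIntegral.integral_sub (cfc.intervalIntegrable _ _) (cE.intervalIntegrable _ _),
    intervalIntegral.integral_ofReal] at hintegral
  rw [hsign, ← Real.norm_eq_abs, ← Complex.norm_real, sub_eq_iff_eq_add.mp hintegral]
  have h1 := norm_add_le (G b - G a) (∫ t in a..b, E t)
  have h2 := norm_sub_le (G b) (G a)
  have h3 := intervalIntegral.norm_integral_le_integral_norm (f := E) (μ := volume) hab
  linarith

theorem integral_norm_le_amgm {E : ℝ → ℂ} (cE : Continuous E) {a b η : ℝ} (hab : a ≤ b)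
    (hη : 0 < η) :
    ∫ t in a..b, ‖E t‖ ≤ η * (b - a) / 2 + 1 / (2 * η) * ∫ t in a..b, ‖E t‖ ^ 2 := by
  have c2 : Continuous (fun t => ‖E t‖ ^ 2) := cE.norm.pow 2
  have : ∫ t in a..b, ‖E t‖ ≤ ∫ t in a..b, (η / 2 + 1 / (2 * η) * ‖E t‖ ^ 2) := by
    refine intervalIntegral.integral_mono_on hab (cE.norm.intervalIntegrable _ _)
      ((continuous_const.add (c2.const_mul _)).intervalIntegrable _ _) fun t _ => ?_
    rw [show η / 2 + 1 / (2 * η) * ‖E t‖ ^ 2 = (η ^ 2 + ‖E t‖ ^ 2) / (2 * η) by field_simp,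
      le_div_iff₀ (by positivity)]
    nlinarith [sq_nonneg (η - ‖E t‖)]
  refine this.trans (le_of_eq ?_)
  rw [intervalIntegral.integral_add (continuous_const.intervalIntegrable _ _)
    ((c2.const_mul _).intervalIntegrable _ _), intervalIntegral.integral_const_mul,
    intervalIntegral.integral_const, smul_eq_mul]
  ring

theorem exists_zeros_of_integral_abs {f : ℝ → ℝ} (cf : Continuous f) {G E : ℝ → ℂ}
    (hG : ∀ t, HasDerivAt G ((f t : ℂ) - E t) t) (cE : Continuous E)
    {L δ η : ℝ} (hδ : 0 < δ) (hη : 0 < η) {M : ℕ} (hM : L = M * δ) (hM1 : 1 ≤ M) :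
    ∃ (J : Finset ℕ) (z : ℕ → ℝ),
      (∀ j ∈ J, z j ∈ Set.Icc 0 L ∧ f (z j) = 0 ∧ ((j : ℝ) - 1) * δ ≤ z j ∧
        z j ≤ ((j : ℝ) + 1) * δ) ∧
      ∫ t in (0:ℝ)..L, |f t| ≤ 2 / δ * (∫ t in (0:ℝ)..L, ‖G t‖) + (∫ t in (0:ℝ)..L, ‖E t‖)
        + η * δ * (J.card + 2) + 1 / (2 * η) * ∫ t in (0:ℝ)..L, f t ^ 2 := by
  classical
  have cG : Continuous G := continuous_iff_continuousAt.mpr fun t => (hG t).continuousAt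
  have hL : 0 ≤ L := by rw [hM]; positivity
  have hσ : ∀ j : ℕ, ∃ s ∈ Set.Icc ((j : ℝ) * δ) (((j + 1 : ℕ) : ℝ) * δ),
      ‖G s‖ * (((j + 1 : ℕ) : ℝ) * δ - (j : ℝ) * δ)
        ≤ ∫ t in ((j : ℝ) * δ)..(((j + 1 : ℕ) : ℝ) * δ), ‖G t‖ := fun j =>
    exists_mul_le_integral cG.norm (by push_cast; nlinarith)
  choose σ hσ1 hσ2 using hσ
  set τ : ℕ → ℝ := fun j => Nat.casesOn j 0 (fun i => if i < M then σ i else L) with hτ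
  set b : ℕ → ℝ := fun j => Nat.casesOn j 0 (fun i => if i < M then ‖G (σ i)‖ else 0) with hb
  have τ0 : τ 0 = 0 := rfl
  have τs : ∀ i, τ (i + 1) = if i < M then σ i else L := fun i => rfl
  have b0 : b 0 = 0 := rfl
  have bs : ∀ i, b (i + 1) = if i < M then ‖G (σ i)‖ else 0 := fun i => rfl
  have bnn : ∀ j, 0 ≤ b j := by
    intro j
    rcases j with _ | i
    · exact b0.ge
    · rw [bs]; split_ifs <;> positivity
  have τlo : ∀ j ≤ M + 1, ((j : ℝ) - 1) * δ ≤ τ j := by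
    intro j hj
    rcases j with _ | i
    · rw [τ0]; push_cast; nlinarith
    · rw [τs]; split_ifs with hi
      · have := (hσ1 i).1; push_cast; nlinarith
      · have : i = M := by omega
        rw [hM, this]; push_cast; nlinarith
  have τhi : ∀ j ≤ M + 1, τ j ≤ (j : ℝ) * δ := by
    intro j hj
    rcases j with _ | i
    · rw [τ0]; simp
    · rw [τs]; split_ifs with hi
      · exact (hσ1 i).2
      · have : i = M := by omega
        rw [hM, this]; push_cast; nlinarith
  have τmono : ∀ j ≤ M, τ j ≤ τ (j + 1) := by
    intro j hj
    refine (τhi j (by omega)).trans ?_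
    have := τlo (j + 1) (by omega)
    push_cast at this
    linarith
  have τmem : ∀ j ≤ M + 1, τ j ∈ Set.Icc 0 L := by
    intro j hj
    rcases j with _ | i
    · exact ⟨τ0.ge, by rw [τ0]; exact hL⟩
    · rw [τs]; split_ifs with hi
      · refine ⟨(by positivity : (0:ℝ) ≤ (i:ℝ) * δ).trans (hσ1 i).1, (hσ1 i).2.trans ?_⟩
        rw [hM]
        have : ((i + 1 : ℕ) : ℝ) ≤ M := by exact_mod_cast hi
        gcongr
      · exact ⟨hL, le_rfl⟩
  have τlast : τ (M + 1) = L := by rw [τs, if_neg (lt_irrefl _)]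
  have hdecomp : ∀ h : ℝ → ℝ, Continuous h →
      ∫ t in (0:ℝ)..L, h t = ∑ j ∈ Finset.range (M + 1), ∫ t in (τ j)..(τ (j + 1)), h t := by
    intro h ch
    rw [intervalIntegral.sum_integral_adjacent_intervals (fun k _ => ch.intervalIntegrable _ _),
      τ0, τlast]
  set J : Finset ℕ := (Finset.range (M + 1)).filter
    (fun j => ∃ s ∈ Set.Icc (τ j) (τ (j + 1)), f s = 0) with hJ
  have hz : ∀ j : ℕ, ∃ s, j ∈ J → s ∈ Set.Icc (τ j) (τ (j + 1)) ∧ f s = 0 := by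
    intro j
    by_cases hj : j ∈ J
    · obtain ⟨s, hs⟩ := (Finset.mem_filter.mp hj).2
      exact ⟨s, fun _ => hs⟩
    · exact ⟨0, fun h => absurd h hj⟩
  choose z hz using hz
  refine ⟨J, z, ?_, ?_⟩
  · intro j hj
    obtain ⟨h1, h2⟩ := hz j hj
    have hjM : j < M + 1 := Finset.mem_range.mp (Finset.mem_filter.mp hj).1
    refine ⟨⟨(τmem j hjM.le).1.trans h1.1, h1.2.trans (τmem (j + 1) hjM).2⟩, h2, ?_, ?_⟩
    · exact (τlo j hjM.le).trans h1.1
    · refine h1.2.trans ?_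
      have := τhi (j + 1) hjM
      push_cast at this
      exact this
  · set J' : Finset ℕ := J ∪ {0, M} with hJ'
    have hJ'card : (J'.card : ℝ) ≤ J.card + 2 := by
      have h1 : J'.card ≤ J.card + ({0, M} : Finset ℕ).card := Finset.card_union_le _ _
      have h2 : ({0, M} : Finset ℕ).card ≤ 2 := Finset.card_le_two
      exact_mod_cast h1.trans (by omega)
    have cf2 : Continuous (fun t => f t ^ 2) := cf.pow 2
    have hpiece : ∀ j ∈ Finset.range (M + 1), ∫ t in (τ j)..(τ (j + 1)), |f t| ≤
        (b j + b (j + 1)) + (∫ t in (τ j)..(τ (j + 1)), ‖E t‖) + (if j ∈ J' then η * δ else 0)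
        + 1 / (2 * η) * ∫ t in (τ j)..(τ (j + 1)), f t ^ 2 := by
      intro j hj
      have hjM : j < M + 1 := Finset.mem_range.mp hj
      have hm := τmono j (by omega)
      have i1 : 0 ≤ ∫ t in (τ j)..(τ (j + 1)), ‖E t‖ :=
        intervalIntegral.integral_nonneg hm fun t _ => norm_nonneg _
      have i2 : 0 ≤ 1 / (2 * η) * ∫ t in (τ j)..(τ (j + 1)), f t ^ 2 :=
        mul_nonneg (by positivity) (intervalIntegral.integral_nonneg hm fun t _ => sq_nonneg _)
      have i3 := bnn j
      have i4 := bnn (j + 1)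
      split_ifs with hjJ
      · have h1 := integral_norm_le_amgm (E := fun t => (f t : ℂ))
          (Complex.continuous_ofReal.comp cf) hm hη
        simp only [Complex.norm_real, Real.norm_eq_abs, sq_abs] at h1
        have h2 : τ (j + 1) - τ j ≤ 2 * δ := by
          have e1 := τhi (j + 1) hjM
          have e2 := τlo j hjM.le
          push_cast at e1
          linarith
        have h3 : η * (τ (j + 1) - τ j) / 2 ≤ η * δ := by nlinarith
        linarith
      · have hj0 : j ≠ 0 := fun h => hjJ (by simp [hJ', h])
        have hjM' : j ≠ M := fun h => hjJ (by simp [hJ', h])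
        have hjJ2 : j ∉ J := fun h => hjJ (Finset.mem_union_left _ h)
        have hne : ∀ t ∈ Set.Icc (τ j) (τ (j + 1)), f t ≠ 0 := fun t ht h0 =>
          hjJ2 (Finset.mem_filter.mpr ⟨hj, t, ht, h0⟩)
        have h1 := integral_abs_le_of_ne_zero cf hG cE hm hne
        obtain ⟨i, rfl⟩ := Nat.exists_eq_succ_of_ne_zero hj0
        have e1 : b (i + 1) = ‖G (τ (i + 1))‖ := by
          rw [bs, τs, if_pos (by omega), if_pos (by omega)]
        have e2 : b (i + 1 + 1) = ‖G (τ (i + 1 + 1))‖ := by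
          rw [bs, τs, if_pos (by omega), if_pos (by omega)]
        simp only [Nat.succ_eq_add_one] at *
        linarith
    have hbsum : ∑ j ∈ Finset.range (M + 1), (b j + b (j + 1)) ≤
        2 / δ * ∫ t in (0:ℝ)..L, ‖G t‖ := by
      have hs : ∑ j ∈ Finset.range M, b (j + 1) ≤ 1 / δ * ∫ t in (0:ℝ)..L, ‖G t‖ := by
        have hG' : ∫ t in (0:ℝ)..L, ‖G t‖ = ∑ j ∈ Finset.range M,
            ∫ t in ((j : ℝ) * δ)..(((j + 1 : ℕ) : ℝ) * δ), ‖G t‖ := by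
          rw [intervalIntegral.sum_integral_adjacent_intervals (a := fun j : ℕ => (j : ℝ) * δ)
            (fun k _ => cG.norm.intervalIntegrable _ _)]
          simp [hM]
        rw [hG', Finset.mul_sum]
        refine Finset.sum_le_sum fun j hj => ?_
        rw [bs, if_pos (Finset.mem_range.mp hj), one_div, inv_mul_eq_div, le_div_iff₀ hδ]
        have := hσ2 j
        rwa [show (((j + 1 : ℕ) : ℝ) * δ - (j : ℝ) * δ) = δ by push_cast; ring] at this
      rw [Finset.sum_add_distrib, Finset.sum_range_succ' b,
        Finset.sum_range_succ (fun j => b (j + 1)),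
        b0, bs M, if_neg (lt_irrefl _)]
      calc _ = 2 * ∑ j ∈ Finset.range M, b (j + 1) := by ring
        _ ≤ 2 * (1 / δ * ∫ t in (0:ℝ)..L, ‖G t‖) := by gcongr
        _ = _ := by ring
    have hJsum : ∑ j ∈ Finset.range (M + 1), (if j ∈ J' then η * δ else 0)
        ≤ η * δ * (J.card + 2) := by
      rw [← Finset.sum_filter, Finset.sum_const, nsmul_eq_mul, mul_comm]
      have : ((Finset.range (M + 1)).filter (fun j => j ∈ J')).card ≤ J'.card :=
        Finset.card_le_card fun j hj => (Finset.mem_filter.mp hj).2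
      have : (((Finset.range (M + 1)).filter (fun j => j ∈ J')).card : ℝ) ≤ J'.card := by
        exact_mod_cast this
      gcongr
      linarith
    rw [hdecomp _ cf.abs, hdecomp _ cE.norm, hdecomp _ cf2, Finset.mul_sum]
    refine (Finset.sum_le_sum hpiece).trans ?_
    rw [Finset.sum_add_distrib, Finset.sum_add_distrib, Finset.sum_add_distrib]
    linarith

/-- The Euclidean inner product on `ℝ × ℝ`. -/
def dot (u w : ℝ × ℝ) : ℝ := u.1 * w.1 + u.2 * w.2

theorem HasDerivAt.dot_left {g : ℝ → ℝ × ℝ} {g' : ℝ × ℝ} {t : ℝ} (h : HasDerivAt g g' t)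
    (u : ℝ × ℝ) : HasDerivAt (fun s => dot u (g s)) (dot u g') t := by
  have h1 : HasDerivAt (fun s => (g s).1) g'.1 t :=
    (hasFDerivAt_fst (𝕜 := ℝ) (p := g t)).comp_hasDerivAt t h
  have h2 : HasDerivAt (fun s => (g s).2) g'.2 t :=
    (hasFDerivAt_snd (𝕜 := ℝ) (p := g t)).comp_hasDerivAt t h
  exact (h1.const_mul u.1).add (h2.const_mul u.2)

theorem abs_dot_le {u : ℝ × ℝ} (hu : u.1 ^ 2 + u.2 ^ 2 = 1) (w : ℝ × ℝ) :
    |dot u w| ≤ |w.1| + |w.2| := by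
  have h1 : |u.1| ≤ 1 := by rw [← sq_le_one_iff_abs_le_one]; nlinarith [sq_nonneg u.2]
  have h2 : |u.2| ≤ 1 := by rw [← sq_le_one_iff_abs_le_one]; nlinarith [sq_nonneg u.1]
  calc |dot u w| ≤ |u.1 * w.1| + |u.2 * w.2| := abs_add_le _ _
    _ = |u.1| * |w.1| + |u.2| * |w.2| := by rw [abs_mul, abs_mul]
    _ ≤ 1 * |w.1| + 1 * |w.2| := by gcongr
    _ = _ := by ring

theorem dot_sq_add_dot_sq {u p n : ℝ × ℝ} (hu : u.1 ^ 2 + u.2 ^ 2 = 1)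
    (hp : p.1 ^ 2 + p.2 ^ 2 = 1) (hpn : dot p n = 0) :
    (n.1 ^ 2 + n.2 ^ 2) * dot u p ^ 2 + dot u n ^ 2 = n.1 ^ 2 + n.2 ^ 2 := by
  unfold dot at *
  obtain ⟨u1, u2⟩ := u
  obtain ⟨p1, p2⟩ := p
  obtain ⟨n1, n2⟩ := n
  simp only at *
  set k := p1 * n2 - p2 * n1 with hk
  have e1 : n1 = - k * p2 := by linear_combination (-n1) * hp + p1 * hpn
  have e2 : n2 = k * p1 := by linear_combination (-n2) * hp + p2 * hpn
  clear_value k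
  subst e1 e2
  linear_combination (k ^ 2 * (u1 * p1 + u2 * p2) ^ 2) * hp
    + k ^ 2 * (p1 ^ 2 + p2 ^ 2) * hu

theorem dot_deriv_eq_zero_of_unit {L : ℝ} (hL : 0 < L) {g g1 : ℝ → ℝ × ℝ}
    (hg : ∀ t, HasDerivAt g (g1 t) t) (cg1 : Continuous g1)
    (hunit : ∀ t ∈ Set.Icc (0:ℝ) L, (g t).1 ^ 2 + (g t).2 ^ 2 = 1) :
    ∀ t ∈ Set.Icc (0:ℝ) L, dot (g t) (g1 t) = 0 := by
  have cg : Continuous g := continuous_iff_continuousAt.2 fun t => (hg t).continuousAt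
  have hc : IsClosed {t | dot (g t) (g1 t) = 0} := by
    apply isClosed_eq _ continuous_const
    unfold dot
    fun_prop
  have hintegral : Set.Ioo (0:ℝ) L ⊆ {t | dot (g t) (g1 t) = 0} := by
    intro t ht
    have h1 : HasDerivAt (fun s => (g s).1) (g1 t).1 t :=
      (hasFDerivAt_fst (𝕜 := ℝ) (p := g t)).comp_hasDerivAt t (hg t)
    have h2 : HasDerivAt (fun s => (g s).2) (g1 t).2 t :=
      (hasFDerivAt_snd (𝕜 := ℝ) (p := g t)).comp_hasDerivAt t (hg t)
    have h3 := (h1.pow 2).add (h2.pow 2)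
    have h4 : HasDerivAt ((fun s => (g s).1) ^ 2 + (fun s => (g s).2) ^ 2) 0 t := by
      refine (hasDerivAt_const t (1:ℝ)).congr_of_eventuallyEq ?_
      filter_upwards [isOpen_Ioo.mem_nhds ht] with s hs
      simpa using hunit s (Set.Ioo_subset_Icc_self hs)
    have := h3.unique h4
    simp only [Set.mem_ofPred_eq, dot]
    push_cast at this
    linarith
  have := closure_minimal hintegral hc
  rwa [closure_Ioo hL.ne] at this

theorem e2_sq (x : ℝ × ℝ) : e2 x ^ 2 = x.1 ^ 2 + x.2 ^ 2 := Real.sq_sqrt (by positivity)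

/-- A plane curve such that all linear phases in unit directions are uniformly nondegenerate
on `[0, L]`. -/
def IsUniformCurve (L A B : ℝ) (γ : ℝ → ℝ × ℝ) : Prop :=
  ∀ u : ℝ × ℝ, u.1 ^ 2 + u.2 ^ 2 = 1 →
    IsPhase L A B (fun t => dot u (γ t)) (fun t => dot u (deriv γ t))
      (fun t => dot u (deriv (deriv γ) t)) (fun t => dot u (deriv (deriv (deriv γ)) t))

theorem exists_isUniformCurve {L k : ℝ} {γ : ℝ → ℝ × ℝ} (hL : 0 < L) (hk : 0 < k)
    (hγ : ContDiff ℝ (⊤ : ℕ∞) γ) (hunit : ∀ t ∈ Set.Icc (0:ℝ) L, e2 (deriv γ t) = 1)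
    (hcurv : ∀ t ∈ Set.Icc (0:ℝ) L, k ≤ e2 (deriv (deriv γ) t)) :
    ∃ A B : ℝ, 0 ≤ A ∧ 1 ≤ B ∧ IsUniformCurve L A B γ := by
  have hs1 : ContDiff ℝ (⊤ : ℕ∞) (deriv γ) := (contDiff_infty_iff_deriv.mp hγ).2
  have hs2 : ContDiff ℝ (⊤ : ℕ∞) (deriv (deriv γ)) := (contDiff_infty_iff_deriv.mp hs1).2
  have hs3 : ContDiff ℝ (⊤ : ℕ∞) (deriv (deriv (deriv γ))) := (contDiff_infty_iff_deriv.mp hs2).2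
  have d0 : ∀ t, HasDerivAt γ (deriv γ t) t := fun t =>
    ((contDiff_infty_iff_deriv.mp hγ).1 t).hasDerivAt
  have d1 : ∀ t, HasDerivAt (deriv γ) (deriv (deriv γ) t) t := fun t =>
    ((contDiff_infty_iff_deriv.mp hs1).1 t).hasDerivAt
  have d2 : ∀ t, HasDerivAt (deriv (deriv γ)) (deriv (deriv (deriv γ)) t) t := fun t =>
    ((contDiff_infty_iff_deriv.mp hs2).1 t).hasDerivAt
  have hu : ∀ t ∈ Set.Icc (0:ℝ) L, (deriv γ t).1 ^ 2 + (deriv γ t).2 ^ 2 = 1 := fun t ht => by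
    rw [← e2_sq, hunit t ht, one_pow]
  have horth := dot_deriv_eq_zero_of_unit hL d1 hs2.continuous hu
  have hbd : ∀ g : ℝ → ℝ × ℝ, Continuous g →
      ∃ C, ∀ t ∈ Set.Icc (0:ℝ) L, |(g t).1| + |(g t).2| ≤ C := by
    intro g cg
    obtain ⟨C, hC⟩ := (isCompact_Icc (a := (0:ℝ)) (b := L)).exists_bound_of_continuousOn
      (f := fun t => |(g t).1| + |(g t).2|) (by fun_prop)
    exact ⟨C, fun t ht => (le_abs_self _).trans (hC t ht)⟩
  obtain ⟨B1, hB1⟩ := hbd _ hs2.continuous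
  obtain ⟨B2, hB2⟩ := hbd _ hs3.continuous
  refine ⟨1 / k ^ 2, max 1 (max B1 B2), by positivity, le_max_left _ _, fun u hu1 => ?_⟩
  refine ⟨fun t => (d0 t).dot_left u, fun t => (d1 t).dot_left u, fun t => (d2 t).dot_left u,
    ?_, ?_, ?_, ?_⟩
  · have := hs3.continuous
    unfold dot
    fun_prop
  · intro t ht
    have h := dot_sq_add_dot_sq hu1 (hu t ht) (horth t ht)
    have hn : k ^ 2 ≤ (deriv (deriv γ) t).1 ^ 2 + (deriv (deriv γ) t).2 ^ 2 := by
      rw [← e2_sq]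
      gcongr
      exact hcurv t ht
    set n := (deriv (deriv γ) t).1 ^ 2 + (deriv (deriv γ) t).2 ^ 2
    set x := dot u (deriv γ t)
    set y := dot u (deriv (deriv γ) t)
    have hx : 0 ≤ 1 - x ^ 2 := by
      have hn0 : 0 < n := lt_of_lt_of_le (by positivity) hn
      have : 0 ≤ n * (1 - x ^ 2) := by nlinarith [sq_nonneg y]
      exact nonneg_of_mul_nonneg_right this hn0
    have : 1 - x ^ 2 ≤ 1 / k ^ 2 * y ^ 2 := by
      rw [one_div, inv_mul_eq_div, le_div_iff₀ (by positivity)]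
      nlinarith
    linarith
  · exact fun t ht => (abs_dot_le hu1 _).trans ((hB1 t ht).trans
      ((le_max_left _ _).trans (le_max_right _ _)))
  · exact fun t ht => (abs_dot_le hu1 _).trans ((hB2 t ht).trans
      ((le_max_right _ _).trans (le_max_right _ _)))

/-- The plane wave `e^{i⟨μ, x⟩}` restricted to the curve `γ`. -/
def wave (γ : ℝ → ℝ × ℝ) (μ : ℤ × ℤ) (t : ℝ) : ℂ :=
  Complex.exp (Complex.I * Complex.ofReal ((μ.1 : ℝ) * (γ t).1 + (μ.2 : ℝ) * (γ t).2))

theorem norm_wave (γ : ℝ → ℝ × ℝ) (μ : ℤ × ℤ) (t : ℝ) : ‖wave γ μ t‖ = 1 := by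
  rw [wave, mul_comm, Complex.norm_exp_ofReal_mul_I]

theorem wave_mul_conj_wave (γ : ℝ → ℝ × ℝ) (μ ν : ℤ × ℤ) (t : ℝ) :
    wave γ μ t * starRingEnd ℂ (wave γ ν t) = wave γ (μ - ν) t := by
  simp only [wave]
  rw [← Complex.exp_conj, ← Complex.exp_add]
  congr 1
  simp only [map_mul, Complex.conj_I, Complex.conj_ofReal, Prod.fst_sub, Prod.snd_sub]
  push_cast
  ring

theorem continuous_wave {γ : ℝ → ℝ × ℝ} (hγ : Continuous γ) (μ : ℤ × ℤ) :
    Continuous (wave γ μ) := by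
  unfold wave
  fun_prop

theorem wave_eq_exp_smul (γ : ℝ → ℝ × ℝ) (μ : ℤ × ℤ) {r : ℝ} (hr : r ≠ 0) (t : ℝ) :
    wave γ μ t =
      Complex.exp (Complex.I * ((r * dot ((μ.1 : ℝ) / r, (μ.2 : ℝ) / r) (γ t) : ℝ) : ℂ)) := by
  simp only [wave, dot]
  congr 3
  field_simp

theorem intSq_cast (ξ : ℤ × ℤ) : ((intSq ξ : ℤ) : ℝ) = (ξ.1 : ℝ) ^ 2 + (ξ.2 : ℝ) ^ 2 := by
  simp [intSq]

theorem unit_of_intSq {ξ : ℤ × ℤ} (hξ : ξ ≠ 0) :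
    0 < √((intSq ξ : ℤ) : ℝ) ∧
    ((ξ.1 : ℝ) / √((intSq ξ : ℤ) : ℝ)) ^ 2 + ((ξ.2 : ℝ) / √((intSq ξ : ℤ) : ℝ)) ^ 2 = 1 := by
  have h : (0:ℝ) < ((intSq ξ : ℤ) : ℝ) := by exact_mod_cast intSq_pos hξ
  refine ⟨Real.sqrt_pos.mpr h, ?_⟩
  rw [div_pow, div_pow, Real.sq_sqrt h.le, ← add_div, ← intSq_cast, div_self (ne_of_gt h)]

/-- The constant in the decay estimate for oscillatory integrals along the curve. -/
def decayConst (L A B : ℝ) : ℝ := L + A * (π / 2 * (2 * B + L * B)) + 2 + L + L * B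

namespace IsUniformCurve

variable {L A B : ℝ} {γ : ℝ → ℝ × ℝ}

theorem norm_integral_mul_wave_le (h : IsUniformCurve L A B γ) (hL : 0 ≤ L) (hA : 0 ≤ A)
    {θ : ℝ} (hθ : 0 < θ) (hθ1 : θ ≤ 1) {ξ : ℤ × ℤ} (hr : 1 ≤ √((intSq ξ : ℤ) : ℝ) * θ ^ 3)
    {W W1 : ℝ → ℝ} (hW : ∀ t, HasDerivAt W (W1 t) t) (cW1 : Continuous W1) {D : ℝ} (hD : 1 ≤ D)
    (bW : ∀ t ∈ Set.Icc (0:ℝ) L, |W t| ≤ 1) (bW1 : ∀ t ∈ Set.Icc (0:ℝ) L, |W1 t| ≤ D) :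
    ‖∫ t in (0:ℝ)..L, (W t : ℂ) * wave γ ξ t‖ ≤ decayConst L A B * D * θ := by
  have hξ : ξ ≠ 0 := by
    rintro rfl
    simp [intSq] at hr
    linarith
  obtain ⟨hpos, hu⟩ := unit_of_intSq hξ
  simp_rw [wave_eq_exp_smul γ ξ hpos.ne']
  exact (h (_, _) hu).norm_integral_mul_exp_le hL hA hθ hθ1 hr hW cW1 hD bW bW1

theorem exists_norm_integral_wave_le (h : IsUniformCurve L A B γ) (hL : 0 < L) (hA : 0 ≤ A) :
    ∃ c > 0, c ≤ L ∧ ∀ ξ : ℤ × ℤ, ξ ≠ 0 → ‖∫ t in (0:ℝ)..L, wave γ ξ t‖ ≤ L - c := by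
  set K := |decayConst L A B| + 1 with hK
  have hKpos : 0 < K := by positivity
  set θ := min 1 (L / (2 * K)) with hθ
  have hθpos : 0 < θ := lt_min one_pos (by positivity)
  have hθ1 : θ ≤ 1 := min_le_left _ _
  have hθ2 : K * θ ≤ L / 2 := by
    have : θ ≤ L / (2 * K) := min_le_right _ _
    calc K * θ ≤ K * (L / (2 * K)) := by gcongr
      _ = L / 2 := by field_simp
  obtain ⟨n, hn⟩ := exists_nat_ge (1 / θ ^ 3)
  have hlarge : ∀ ξ : ℤ × ℤ, (n:ℝ) ≤ √((intSq ξ : ℤ) : ℝ) →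
      ‖∫ t in (0:ℝ)..L, wave γ ξ t‖ ≤ L / 2 := by
    intro ξ hξ
    have hr : 1 ≤ √((intSq ξ : ℤ) : ℝ) * θ ^ 3 := by
      rw [← div_le_iff₀ (by positivity)]
      linarith
    have := h.norm_integral_mul_wave_le hL.le hA hθpos hθ1 hr (W := fun _ => 1) (W1 := fun _ => 0)
      (fun t => hasDerivAt_const t 1) continuous_const (D := 1) le_rfl (by simp) (by simp)
    simp only [Complex.ofReal_one, one_mul, mul_one] at this
    refine this.trans (le_trans ?_ hθ2)
    gcongr
    rw [hK]
    linarith [le_abs_self (decayConst L A B)]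
  set box : Finset (ℤ × ℤ) := (Finset.Icc (-(n:ℤ), -(n:ℤ)) ((n:ℤ), (n:ℤ))).filter (fun ξ => ξ ≠ 0)
    with hbox
  have hpos : ∀ ξ ∈ box, 0 < L - ‖∫ t in (0:ℝ)..L, wave γ ξ t‖ := by
    intro ξ hξ
    have hξ0 := (Finset.mem_filter.mp hξ).2
    obtain ⟨hp, hu⟩ := unit_of_intSq hξ0
    simp_rw [wave_eq_exp_smul γ ξ hp.ne']
    linarith [(h (_, _) hu).norm_integral_exp_lt hL hp]
  obtain ⟨c, hc0, hc⟩ : ∃ c > 0, ∀ ξ ∈ box, c ≤ L - ‖∫ t in (0:ℝ)..L, wave γ ξ t‖ := by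
    rcases box.eq_empty_or_nonempty with he | hne
    · exact ⟨1, one_pos, by simp [he]⟩
    · obtain ⟨ξ0, h0, hmin⟩ := box.exists_min_image
        (fun ξ => L - ‖∫ t in (0:ℝ)..L, wave γ ξ t‖) hne
      exact ⟨_, hpos ξ0 h0, hmin⟩
  refine ⟨min c (L / 2), lt_min hc0 (by positivity), (min_le_right _ _).trans (by linarith),
    fun ξ hξ => ?_⟩
  by_cases hb : ξ ∈ box
  · linarith [hc ξ hb, min_le_left c (L / 2)]
  · have : (n:ℝ) ≤ √((intSq ξ : ℤ) : ℝ) := by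
      apply Real.le_sqrt_of_sq_le
      have : (n:ℤ) ^ 2 ≤ intSq ξ := by
        by_contra hlt
        push Not at hlt
        apply hb
        rw [hbox, Finset.mem_filter, Finset.mem_Icc]
        unfold intSq at hlt
        have h1 : |ξ.1| ≤ |(n:ℤ)| := sq_le_sq.mp (by nlinarith [sq_nonneg ξ.2])
        have h2 : |ξ.2| ≤ |(n:ℤ)| := sq_le_sq.mp (by nlinarith [sq_nonneg ξ.1])
        rw [abs_of_nonneg (Int.natCast_nonneg n)] at h1 h2
        exact ⟨⟨⟨(abs_le.mp h1).1, (abs_le.mp h2).1⟩, ⟨(abs_le.mp h1).2, (abs_le.mp h2).2⟩⟩, hξ⟩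
      exact_mod_cast this
    linarith [hlarge ξ this, min_le_right c (L / 2)]

end IsUniformCurve

theorem integral_exp_int_mul (n : ℤ) :
    ∫ t in Set.Icc (0:ℝ) (2 * π), Complex.exp (Complex.I * ((n : ℝ) : ℂ) * (t : ℂ))
      = if n = 0 then (2 * π : ℂ) else 0 := by
  rw [integral_Icc_eq_integral_Ioc, ← intervalIntegral.integral_of_le (by positivity)]
  split_ifs with h
  · simp [h]
  · rw [integral_exp_mul_complex]
    · have : Complex.I * ((n : ℝ) : ℂ) * ((2 * π : ℝ) : ℂ) = n * (2 * π * Complex.I) := by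
        push_cast; ring
      rw [this, Complex.exp_int_mul_two_pi_mul_I]
      simp
    · simpa using h

theorem integral_torus_exp (ξ : ℤ × ℤ) :
    ∫ x in (Set.Icc (0:ℝ) (2 * π)) ×ˢ (Set.Icc (0:ℝ) (2 * π)),
      Complex.exp (Complex.I * Complex.ofReal ((ξ.1 : ℝ) * x.1 + (ξ.2 : ℝ) * x.2))
      = if ξ = 0 then ((2 * π) ^ 2 : ℂ) else 0 := by
  have h : ∀ x : ℝ × ℝ, Complex.exp (Complex.I * Complex.ofReal ((ξ.1 : ℝ) * x.1 + (ξ.2 : ℝ) * x.2))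
      = Complex.exp (Complex.I * ((ξ.1 : ℝ) : ℂ) * (x.1 : ℂ))
        * Complex.exp (Complex.I * ((ξ.2 : ℝ) : ℂ) * (x.2 : ℂ)) := by
    intro x
    rw [← Complex.exp_add]
    congr 1
    push_cast
    ring
  simp_rw [h]
  rw [Measure.volume_eq_prod, setIntegral_prod_mul
    (f := fun t : ℝ => Complex.exp (Complex.I * ((ξ.1 : ℝ) : ℂ) * (t : ℂ)))
    (g := fun t : ℝ => Complex.exp (Complex.I * ((ξ.2 : ℝ) : ℂ) * (t : ℂ))),
    integral_exp_int_mul, integral_exp_int_mul]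
  by_cases h1 : ξ.1 = 0 <;> by_cases h2 : ξ.2 = 0 <;> simp [h1, h2, Prod.ext_iff, sq]

theorem integral_torus_norm_efn_sq (lam : ℝ) (a : ℤ × ℤ → ℂ) :
    ∫ x in (Set.Icc (0:ℝ) (2 * π)) ×ˢ (Set.Icc (0:ℝ) (2 * π)), ‖efn lam a x‖ ^ 2
      = (2 * π) ^ 2 * ∑ μ ∈ Elat lam, ‖a μ‖ ^ 2 := by
  set e : ℤ × ℤ → ℝ × ℝ → ℂ := fun ξ x =>
    Complex.exp (Complex.I * Complex.ofReal ((ξ.1 : ℝ) * x.1 + (ξ.2 : ℝ) * x.2)) with he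
  have ce : ∀ ξ, Continuous (e ξ) := fun ξ => by rw [he]; fun_prop
  have hcomp : IsCompact ((Set.Icc (0:ℝ) (2 * π)) ×ˢ (Set.Icc (0:ℝ) (2 * π))) :=
    isCompact_Icc.prod isCompact_Icc
  have hmul : ∀ μ ν x, e μ x * starRingEnd ℂ (e ν x) = e (μ - ν) x := by
    intro μ ν x
    simp only [he]
    rw [← Complex.exp_conj, ← Complex.exp_add]
    congr 1
    simp only [map_mul, Complex.conj_I, Complex.conj_ofReal, Prod.fst_sub, Prod.snd_sub]
    push_cast
    ring
  have hexp : ∀ x, ((‖efn lam a x‖ ^ 2 : ℝ) : ℂ)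
      = ∑ μ ∈ Elat lam, ∑ ν ∈ Elat lam, a μ * starRingEnd ℂ (a ν) * e (μ - ν) x := by
    intro x
    have : efn lam a x = ∑ μ ∈ Elat lam, a μ * e μ x := rfl
    rw [Complex.ofReal_pow, ← Complex.mul_conj', this, map_sum, Finset.sum_mul_sum]
    refine Finset.sum_congr rfl fun μ _ => Finset.sum_congr rfl fun ν _ => ?_
    rw [← hmul, map_mul]
    ring
  have hC : ((∫ x in (Set.Icc (0:ℝ) (2 * π)) ×ˢ (Set.Icc (0:ℝ) (2 * π)), ‖efn lam a x‖ ^ 2 : ℝ) : ℂ)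
      = (((2 * π) ^ 2 * ∑ μ ∈ Elat lam, ‖a μ‖ ^ 2 : ℝ) : ℂ) := by
    rw [← integral_complex_ofReal]
    simp_rw [hexp]
    rw [integral_finsetSum _ fun μ _ => ?_]
    · push_cast
      rw [Finset.mul_sum]
      refine Finset.sum_congr rfl fun μ hμ => ?_
      rw [integral_finsetSum _ fun ν _ => ?_]
      · rw [Finset.sum_eq_single μ]
        · rw [integral_const_mul, integral_torus_exp]
          simp only [sub_self, if_true]
          rw [Complex.mul_conj']
          ring
        · intro ν _ hν
          rw [integral_const_mul, integral_torus_exp, if_neg (sub_ne_zero.mpr hν.symm), mul_zero]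
        · exact fun h => absurd hμ h
      · exact ((continuous_const.mul (ce _)).continuousOn.integrableOn_compact hcomp)
    · exact ((continuous_finsetSum _ fun ν _ =>
        continuous_const.mul (ce _)).continuousOn.integrableOn_compact hcomp)
  exact_mod_cast hC

theorem l2T_efn (lam : ℝ) (a : ℤ × ℤ → ℂ) :
    l2T (efn lam a) = 2 * π * √(∑ μ ∈ Elat lam, ‖a μ‖ ^ 2) := by
  rw [l2T, integral_torus_norm_efn_sq, Real.sqrt_mul (by positivity), Real.sqrt_sq (by positivity)]

theorem conj_efn {lam : ℝ} {a : ℤ × ℤ → ℂ} (ha : ∀ μ : ℤ × ℤ, a (-μ) = starRingEnd ℂ (a μ))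
    (x : ℝ × ℝ) : starRingEnd ℂ (efn lam a x) = efn lam a x := by
  unfold efn
  rw [map_sum]
  refine Finset.sum_nbij' (fun μ => -μ) (fun μ => -μ) (fun μ h => neg_mem_Elat h)
    (fun μ h => neg_mem_Elat h) (by simp) (by simp) fun μ _ => ?_
  rw [map_mul, ha, ← Complex.exp_conj]
  congr 2
  simp only [map_mul, Complex.conj_I, Complex.conj_ofReal, Prod.fst_neg, Prod.snd_neg]
  push_cast
  ring

theorem ofReal_re_efn {lam : ℝ} {a : ℤ × ℤ → ℂ} (ha : ∀ μ : ℤ × ℤ, a (-μ) = starRingEnd ℂ (a μ))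
    (x : ℝ × ℝ) : (((efn lam a x).re : ℝ) : ℂ) = efn lam a x :=
  Complex.conj_eq_iff_re.mp (conj_efn ha x)

theorem norm_efn {lam : ℝ} {a : ℤ × ℤ → ℂ} (ha : ∀ μ : ℤ × ℤ, a (-μ) = starRingEnd ℂ (a μ))
    (x : ℝ × ℝ) : ‖efn lam a x‖ = |(efn lam a x).re| := by
  conv_lhs => rw [← ofReal_re_efn ha x]
  rw [Complex.norm_real, Real.norm_eq_abs]

theorem efn_comp_eq_sum_wave (lam : ℝ) (a : ℤ × ℤ → ℂ) (γ : ℝ → ℝ × ℝ) (t : ℝ) :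
    efn lam a (γ t) = ∑ μ ∈ Elat lam, a μ * wave γ μ t := rfl

theorem norm_efn_le (lam : ℝ) (a : ℤ × ℤ → ℂ) (x : ℝ × ℝ) :
    ‖efn lam a x‖ ≤ √((Elat lam).card) * √(∑ μ ∈ Elat lam, ‖a μ‖ ^ 2) := by
  have h1 : ‖efn lam a x‖ ≤ ∑ μ ∈ Elat lam, ‖a μ‖ := by
    refine (norm_sum_le _ _).trans (Finset.sum_le_sum fun μ _ => ?_)
    rw [norm_mul, mul_comm Complex.I, Complex.norm_exp_ofReal_mul_I, mul_one]
  rw [← Real.sqrt_mul (by positivity)]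
  exact h1.trans (Real.le_sqrt_of_sq_le sq_sum_le_card_mul_sum_sq)

theorem decayConst_nonneg {L A B : ℝ} (hL : 0 ≤ L) (hA : 0 ≤ A) (hB : 0 ≤ B) :
    0 ≤ decayConst L A B := by
  unfold decayConst
  positivity

theorem one_le_sqrt_intSq_mul {lam τ : ℝ} (hτ : 0 < τ) (hlt : 1 ≤ lam * τ ^ 9)
    {μ ν : ℤ × ℤ} (h : ¬ IsClose lam μ ν) : 1 ≤ √((intSq (μ - ν) : ℤ) : ℝ) * τ ^ 3 := by
  unfold IsClose at h
  push Not at h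
  set q : ℝ := ((intSq (μ - ν) : ℤ) : ℝ)
  have hq : 0 ≤ q := by
    by_contra hc
    push Not at hc
    have : q ^ 3 < 0 := Odd.pow_neg (by decide) hc
    nlinarith [sq_nonneg lam]
  have h1 : lam ≤ √q ^ 3 := by
    refine le_of_sq_le_sq ?_ (by positivity)
    calc lam ^ 2 ≤ q ^ 3 := h
      _ = (√q ^ 2) ^ 3 := by rw [Real.sq_sqrt hq]
      _ = _ := by ring
  have h2 : 1 ≤ (√q * τ ^ 3) ^ 3 := by
    calc 1 ≤ lam * τ ^ 9 := hlt
      _ ≤ √q ^ 3 * τ ^ 9 := by gcongr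
      _ = _ := by ring
  by_contra hc
  push Not at hc
  have : (√q * τ ^ 3) ^ 3 < 1 := pow_lt_one₀ (by positivity) hc (by norm_num)
  linarith

namespace IsUniformCurve

variable {L A B : ℝ} {γ : ℝ → ℝ × ℝ}

theorem abs_integral_norm_sq_sub_le (h : IsUniformCurve L A B γ) (cγ : Continuous γ)
    (hL : 0 ≤ L) (hA : 0 ≤ A) (hB : 0 ≤ B)
    {lam τ : ℝ} (hτ : 0 < τ) (hτ1 : τ ≤ 1) (hlt : 1 ≤ lam * τ ^ 9)
    (a : ℤ × ℤ → ℂ) {W W1 : ℤ × ℤ → ℝ → ℝ} {D P : ℝ} (hD : 1 ≤ D) (hP : 0 ≤ P)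
    (hW : ∀ μ ∈ Elat lam, ∀ t, HasDerivAt (W μ) (W1 μ t) t)
    (cW : ∀ μ, Continuous (W μ)) (cW1 : ∀ μ, Continuous (W1 μ))
    (bW : ∀ μ ∈ Elat lam, ∀ t ∈ Set.Icc (0:ℝ) L, |W μ t| ≤ 1)
    (bW1 : ∀ μ ∈ Elat lam, ∀ t ∈ Set.Icc (0:ℝ) L, |W1 μ t| ≤ D)
    (hclose : ∀ μ ∈ Elat lam, ∀ ν ∈ Elat lam, μ ≠ ν →
      ‖∫ t in (0:ℝ)..L, ((W μ t * W ν t : ℝ) : ℂ) * wave γ (μ - ν) t‖ ≤ P) :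
    |(∫ t in (0:ℝ)..L, ‖∑ μ ∈ Elat lam, a μ * ((W μ t : ℂ) * wave γ μ t)‖ ^ 2)
        - ∑ μ ∈ Elat lam, ‖a μ‖ ^ 2 * ∫ t in (0:ℝ)..L, W μ t ^ 2|
      ≤ (P + (Elat lam).card * (decayConst L A B * (2 * D) * τ)) * ∑ μ ∈ Elat lam, ‖a μ‖ ^ 2 := by
  have hK := decayConst_nonneg hL hA hB
  have hmul : ∀ μ ν t, ((W μ t : ℂ) * wave γ μ t) * starRingEnd ℂ ((W ν t : ℂ) * wave γ ν t)
      = ((W μ t * W ν t : ℝ) : ℂ) * wave γ (μ - ν) t := by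
    intro μ ν t
    rw [← wave_mul_conj_wave, map_mul, Complex.conj_ofReal]
    push_cast
    ring
  have key := abs_integral_norm_sq_sub_diag_le (Elat lam) (IsClose lam)
    (fun μ ν => IsClose.symm) (fun μ hμ => by convert card_filter_isClose_le_one hμ) a
    (fun μ t => (W μ t : ℂ) * wave γ μ t)
    (fun μ => (Complex.continuous_ofReal.comp (cW μ)).mul (continuous_wave cγ μ)) L hP
    (B := decayConst L A B * (2 * D) * τ) (by positivity) ?_ ?_
  · have hn : ∀ μ t, ‖(W μ t : ℂ) * wave γ μ t‖ ^ 2 = W μ t ^ 2 := by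
      intro μ t
      rw [norm_mul, norm_wave, mul_one, Complex.norm_real, Real.norm_eq_abs, sq_abs]
    simpa only [hn] using key
  · intro μ hμ ν hν hne _
    simp_rw [hmul]
    exact hclose μ hμ ν hν hne
  · intro μ hμ ν hν hne hfar
    simp_rw [hmul]
    refine h.norm_integral_mul_wave_le hL hA hτ hτ1 (one_le_sqrt_intSq_mul hτ hlt hfar)
      (W := fun t => W μ t * W ν t) (W1 := fun t => W1 μ t * W ν t + W μ t * W1 ν t)
      (fun t => (hW μ hμ t).mul (hW ν hν t))
      (((cW1 μ).mul (cW ν)).add ((cW μ).mul (cW1 ν))) (by linarith) ?_ ?_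
    · intro t ht
      rw [abs_mul]
      exact mul_le_one₀ (bW μ hμ t ht) (abs_nonneg _) (bW ν hν t ht)
    · intro t ht
      calc |W1 μ t * W ν t + W μ t * W1 ν t| ≤ |W1 μ t * W ν t| + |W μ t * W1 ν t| := abs_add_le _ _
        _ = |W1 μ t| * |W ν t| + |W μ t| * |W1 ν t| := by rw [abs_mul, abs_mul]
        _ ≤ D * 1 + 1 * D := by
          have := bW μ hμ t ht; have := bW ν hν t ht
          have := bW1 μ hμ t ht; have := bW1 ν hν t ht
          gcongr
        _ = 2 * D := by ring

theorem abs_integral_norm_efn_sq_sub_le (h : IsUniformCurve L A B γ) (cγ : Continuous γ)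
    (hL : 0 ≤ L) (hA : 0 ≤ A) (hB : 0 ≤ B)
    {lam τ : ℝ} (hτ : 0 < τ) (hτ1 : τ ≤ 1) (hlt : 1 ≤ lam * τ ^ 9)
    (a : ℤ × ℤ → ℂ) {P : ℝ} (hP : 0 ≤ P)
    (hclose : ∀ ξ : ℤ × ℤ, ξ ≠ 0 → ‖∫ t in (0:ℝ)..L, wave γ ξ t‖ ≤ P) :
    |(∫ t in (0:ℝ)..L, ‖efn lam a (γ t)‖ ^ 2) - L * ∑ μ ∈ Elat lam, ‖a μ‖ ^ 2|
      ≤ (P + (Elat lam).card * (decayConst L A B * 2 * τ)) * ∑ μ ∈ Elat lam, ‖a μ‖ ^ 2 := by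
  have key := h.abs_integral_norm_sq_sub_le cγ hL hA hB hτ hτ1 hlt a
    (W := fun _ _ => 1) (W1 := fun _ _ => 0) (D := 1) le_rfl hP
    (fun _ _ t => hasDerivAt_const t 1) (fun _ => continuous_const) (fun _ => continuous_const)
    (by simp) (by simp) (fun μ _ ν _ hne => by simpa using hclose _ (sub_ne_zero.mpr hne))
  simp only [Complex.ofReal_one, one_mul, one_pow, intervalIntegral.integral_const, smul_eq_mul,
    sub_zero, mul_one, ← Finset.sum_mul] at key
  rw [mul_comm L]
  exact key

theorem norm_integral_mul_wave_le_integral {L : ℝ} {γ : ℝ → ℝ × ℝ} (hL : 0 ≤ L)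
    {V U : ℝ → ℝ} (cU : Continuous U) (hVU : ∀ t ∈ Set.Icc (0:ℝ) L, |V t| ≤ U t) (ξ : ℤ × ℤ) :
    ‖∫ t in (0:ℝ)..L, ((V t : ℝ) : ℂ) * wave γ ξ t‖ ≤ ∫ t in (0:ℝ)..L, U t := by
  refine intervalIntegral.norm_integral_le_of_norm_le hL ?_ (cU.intervalIntegrable _ _)
  filter_upwards with t ht
  rw [norm_mul, norm_wave, mul_one, Complex.norm_real, Real.norm_eq_abs]
  exact hVU t (Set.Ioc_subset_Icc_self ht)

set_option maxHeartbeats 1000000 in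
/-- An approximate primitive of the restriction of an eigenfunction to the curve. -/
theorem exists_approx_primitive (h : IsUniformCurve L A B γ) (cγ : Continuous γ)
    (hL : 0 ≤ L) (hA : 0 ≤ A) (hB : 1 ≤ B)
    {lam τ θ : ℝ} (hlam : 0 < lam) (hτ : 0 < τ) (hτ1 : τ ≤ 1) (hlt : 1 ≤ lam * τ ^ 9)
    (hθ : 0 < θ) (hθ1 : θ ≤ 1) (a : ℤ × ℤ → ℂ)
    (hN1 : B * (Elat lam).card * τ ≤ θ ^ 2)
    (hN2 : (Elat lam).card * B ^ 2 ≤ θ ^ 5 * lam ^ 2) :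
    ∃ G E : ℝ → ℂ, (∀ t, HasDerivAt G (efn lam a (γ t) - E t) t) ∧ Continuous E ∧
      (∫ t in (0:ℝ)..L, ‖G t‖ ^ 2)
        ≤ (2 * L + 2 * decayConst L A B) / (θ * lam) ^ 2 * ∑ μ ∈ Elat lam, ‖a μ‖ ^ 2 ∧
      (∫ t in (0:ℝ)..L, ‖E t‖ ^ 2)
        ≤ (8 * decayConst L A B + 2 * L) * θ * ∑ μ ∈ Elat lam, ‖a μ‖ ^ 2 := by
  have hB0 : 0 ≤ B := by linarith
  set K := decayConst L A B with hKdef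
  have hK : 0 ≤ K := decayConst_nonneg hL hA hB0
  set S := ∑ μ ∈ Elat lam, ‖a μ‖ ^ 2 with hS
  have hS0 : 0 ≤ S := by positivity
  set N : ℝ := ((Elat lam).card : ℝ) with hN
  set u : ℤ × ℤ → ℝ × ℝ := fun μ => ((μ.1 : ℝ) / lam, (μ.2 : ℝ) / lam) with hu
  have huu : ∀ μ ∈ Elat lam, (u μ).1 ^ 2 + (u μ).2 ^ 2 = 1 := by
    intro μ hμ
    simp only [hu]
    rw [div_pow, div_pow, ← add_div, sq_add_sq_of_mem_Elat hμ, div_self (by positivity)]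
  set x : ℤ × ℤ → ℝ → ℝ := fun μ t => dot (u μ) (deriv γ t) with hx
  set x1 : ℤ × ℤ → ℝ → ℝ := fun μ t => dot (u μ) (deriv (deriv γ) t) with hx1
  have hph : ∀ μ ∈ Elat lam, IsPhase L A B (fun t => dot (u μ) (γ t)) (x μ) (x1 μ)
      (fun t => dot (u μ) (deriv (deriv (deriv γ)) t)) := fun μ hμ => h (u μ) (huu μ hμ)
  -- continuity for all `μ`, from the two coordinate directions
  have hc10 := h (1, 0) (by norm_num)
  have hc01 := h (0, 1) (by norm_num)
  have cx : ∀ μ, Continuous (x μ) := by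
    intro μ
    have c1 := hc10.continuous_deriv
    have c2 := hc01.continuous_deriv
    simp only [dot, one_mul, zero_mul, add_zero, zero_add] at c1 c2
    simp only [hx, dot]
    fun_prop
  have cx1 : ∀ μ, Continuous (x1 μ) := by
    intro μ
    have c1 := hc10.continuous_deriv2
    have c2 := hc01.continuous_deriv2
    simp only [dot, one_mul, zero_mul, add_zero, zero_add] at c1 c2
    simp only [hx1, dot]
    fun_prop
  have hD : 1 ≤ B / θ := by rw [le_div_iff₀ hθ]; linarith
  have hwave : ∀ μ ∈ Elat lam, ∀ t, HasDerivAt (wave γ μ)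
      (Complex.I * ((lam * x μ t : ℝ) : ℂ) * wave γ μ t) t := by
    intro μ hμ t
    have hw : wave γ μ = fun t => Complex.exp (Complex.I * ((lam * dot (u μ) (γ t) : ℝ) : ℂ)) := by
      funext t
      exact wave_eq_exp_smul γ μ hlam.ne' t
    rw [hw]
    exact (hph μ hμ).hasDerivAt_exp lam t
  have hNτ : N * (K * (2 * (B / θ)) * τ) ≤ 2 * K * θ := by
    calc N * (K * (2 * (B / θ)) * τ) = 2 * K * ((B * N * τ) / θ) := by ring
      _ ≤ 2 * K * (θ ^ 2 / θ) := by gcongr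
      _ = 2 * K * θ := by field_simp
  -- the regularized reciprocal
  have bG := h.abs_integral_norm_sq_sub_le cγ hL hA hB0 hτ hτ1 hlt a
    (W := fun μ t => θ * regInv θ (x μ t)) (W1 := fun μ t => θ * (regInvDeriv θ (x μ t) * x1 μ t))
    hD hL
    (fun μ hμ t => ((hasDerivAt_regInv hθ _).comp t ((hph μ hμ).deriv1 t)).const_mul θ)
    (fun μ => continuous_const.mul ((continuous_regInv hθ).comp (cx μ)))
    (fun μ => continuous_const.mul (((continuous_regInvDeriv hθ).comp (cx μ)).mul (cx1 μ)))
    (fun μ _ t _ => by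
      rw [abs_mul, abs_of_pos hθ]
      calc θ * |regInv θ (x μ t)| ≤ θ * (1 / θ) := by gcongr; exact abs_regInv_le hθ _
        _ = 1 := by field_simp)
    (fun μ hμ t ht => by
      rw [abs_mul, abs_mul, abs_of_pos hθ]
      calc θ * (|regInvDeriv θ (x μ t)| * |x1 μ t|) ≤ θ * (1 / θ ^ 2 * B) := by
            gcongr
            · exact abs_regInvDeriv_le hθ _
            · exact (hph μ hμ).bound1 t ht
        _ = B / θ := by field_simp)
    (fun μ _ ν _ _ => by
      refine (norm_integral_mul_wave_le_integral hL (U := fun _ => 1) continuous_const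
        (fun t _ => ?_) _).trans (by simp)
      have hb : ∀ μ, |θ * regInv θ (x μ t)| ≤ 1 := fun μ => by
        rw [abs_mul, abs_of_pos hθ]
        calc θ * |regInv θ (x μ t)| ≤ θ * (1 / θ) := by gcongr; exact abs_regInv_le hθ _
          _ = 1 := by field_simp
      rw [abs_mul]
      exact mul_le_one₀ (hb μ) (abs_nonneg _) (hb ν))
  have bE := h.abs_integral_norm_sq_sub_le cγ hL hA hB0 hτ hτ1 hlt a
    (W := fun μ t => nearWeight θ (x μ t)) (W1 := fun μ t => nearWeightDeriv θ (x μ t) * x1 μ t)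
    (P := K * θ) hD (by positivity)
    (fun μ hμ t => (hasDerivAt_nearWeight hθ _).comp t ((hph μ hμ).deriv1 t))
    (fun μ => (continuous_nearWeight hθ).comp (cx μ))
    (fun μ => ((continuous_nearWeightDeriv hθ).comp (cx μ)).mul (cx1 μ))
    (fun μ _ t _ => by
      rw [abs_of_nonneg (nearWeight_nonneg _ _)]
      exact nearWeight_le_one _ _)
    (fun μ hμ t ht => by
      rw [abs_mul]
      calc |nearWeightDeriv θ (x μ t)| * |x1 μ t| ≤ 1 / θ * B := by
            gcongr
            · exact abs_nearWeightDeriv_le hθ _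
            · exact (hph μ hμ).bound1 t ht
        _ = B / θ := by ring)
    (fun μ hμ ν _ _ => by
      refine (norm_integral_mul_wave_le_integral hL (U := fun t => nearWeight θ (x μ t))
        ((continuous_nearWeight hθ).comp (cx μ)) (fun t _ => ?_) _).trans ?_
      · rw [abs_of_nonneg (mul_nonneg (nearWeight_nonneg _ _) (nearWeight_nonneg _ _))]
        exact mul_le_of_le_one_right (nearWeight_nonneg _ _) (nearWeight_le_one _ _)
      · refine ((hph μ hμ).integral_nearWeight_le hL hA hθ hθ1).trans ?_
        gcongr
        rw [hKdef, decayConst]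
        nlinarith [mul_nonneg hL hB0])
  have dG : ∑ μ ∈ Elat lam, ‖a μ‖ ^ 2 * ∫ t in (0:ℝ)..L, (θ * regInv θ (x μ t)) ^ 2 ≤ S * L := by
    rw [hS, Finset.sum_mul]
    refine Finset.sum_le_sum fun μ _ => mul_le_mul_of_nonneg_left ?_ (by positivity)
    calc ∫ t in (0:ℝ)..L, (θ * regInv θ (x μ t)) ^ 2 ≤ ∫ t in (0:ℝ)..L, (1:ℝ) := by
          refine intervalIntegral.integral_mono_on hL
            (Continuous.intervalIntegrable ((continuous_const.mul
              ((continuous_regInv hθ).comp (cx μ))).pow 2) _ _) (by simp) fun t _ => ?_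
          rw [sq_le_one_iff_abs_le_one, abs_mul, abs_of_pos hθ]
          calc θ * |regInv θ (x μ t)| ≤ θ * (1 / θ) := by gcongr; exact abs_regInv_le hθ _
            _ = 1 := by field_simp
      _ = L := by simp
  have dE :
      ∑ μ ∈ Elat lam, ‖a μ‖ ^ 2 * ∫ t in (0:ℝ)..L, nearWeight θ (x μ t) ^ 2 ≤ S * (K * θ) := by
    rw [hS, Finset.sum_mul]
    refine Finset.sum_le_sum fun μ hμ => mul_le_mul_of_nonneg_left ?_ (by positivity)
    calc ∫ t in (0:ℝ)..L, nearWeight θ (x μ t) ^ 2 ≤ ∫ t in (0:ℝ)..L, nearWeight θ (x μ t) := by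
          refine intervalIntegral.integral_mono_on hL
            (Continuous.intervalIntegrable (((continuous_nearWeight hθ).comp (cx μ)).pow 2) _ _)
            (Continuous.intervalIntegrable ((continuous_nearWeight hθ).comp (cx μ)) _ _)
            fun t _ => ?_
          exact pow_le_of_le_one (nearWeight_nonneg _ _) (nearWeight_le_one _ _) two_ne_zero
      _ ≤ (L + A * (π / 2 * (2 * B + L * B))) * θ :=
          (hph μ hμ).integral_nearWeight_le hL hA hθ hθ1
      _ ≤ K * θ := by
          gcongr
          rw [hKdef, decayConst]
          nlinarith [mul_nonneg hL hB0]
  set E1 : ℝ → ℂ := fun t =>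
    ∑ μ ∈ Elat lam, a μ * ((nearWeight θ (x μ t) : ℂ) * wave γ μ t) with hE1
  set E2 : ℝ → ℂ := fun t => ∑ μ ∈ Elat lam,
    a μ * (((regInvDeriv θ (x μ t) * x1 μ t : ℝ) : ℂ) / (Complex.I * lam) * wave γ μ t) with hE2
  have cE1 : Continuous E1 := continuous_finsetSum _ fun μ _ => continuous_const.mul
    ((Complex.continuous_ofReal.comp ((continuous_nearWeight hθ).comp (cx μ))).mul
      (continuous_wave cγ μ))
  have cE2 : Continuous E2 := continuous_finsetSum _ fun μ _ => continuous_const.mul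
    (((Complex.continuous_ofReal.comp (((continuous_regInvDeriv hθ).comp (cx μ)).mul
      (cx1 μ))).div_const _).mul (continuous_wave cγ μ))
  have hlamC : (lam : ℂ) ≠ 0 := by exact_mod_cast hlam.ne'
  refine ⟨fun t => ∑ μ ∈ Elat lam, a μ * (((regInv θ (x μ t) : ℝ) : ℂ) / (Complex.I * lam)
    * wave γ μ t), fun t => E1 t - E2 t, ?_, cE1.sub cE2, ?_, ?_⟩
  · intro t
    have hd : ∀ μ ∈ Elat lam, HasDerivAt (fun t => a μ * (((regInv θ (x μ t) : ℝ) : ℂ) /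
        (Complex.I * lam) * wave γ μ t)) (a μ * (((regInvDeriv θ (x μ t) * x1 μ t : ℝ) : ℂ) /
          (Complex.I * lam) * wave γ μ t + ((regInv θ (x μ t) : ℝ) : ℂ) / (Complex.I * lam) *
          (Complex.I * ((lam * x μ t : ℝ) : ℂ) * wave γ μ t))) t := by
      intro μ hμ
      have h1 : HasDerivAt (fun t => regInv θ (x μ t)) (regInvDeriv θ (x μ t) * x1 μ t) t :=
        (hasDerivAt_regInv hθ _).comp t ((hph μ hμ).deriv1 t)
      exact ((h1.ofReal_comp.div_const (Complex.I * lam)).mul (hwave μ hμ t)).const_mul (a μ)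
    have := HasDerivAt.fun_sum hd
    refine this.congr_deriv ?_
    rw [efn_comp_eq_sum_wave]
    simp only [hE1, hE2]
    rw [← Finset.sum_sub_distrib, ← Finset.sum_sub_distrib]
    refine Finset.sum_congr rfl fun μ _ => ?_
    have hsum : regInv θ (x μ t) * x μ t = 1 - nearWeight θ (x μ t) := by
      unfold regInv nearWeight
      have : x μ t ^ 2 + θ ^ 2 ≠ 0 := by positivity
      field_simp
      ring
    have hsumC : ((regInv θ (x μ t) : ℝ) : ℂ) * ((x μ t : ℝ) : ℂ)
        = 1 - ((nearWeight θ (x μ t) : ℝ) : ℂ) := by exact_mod_cast hsum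
    have h3 : ((regInv θ (x μ t) : ℝ) : ℂ) / (Complex.I * lam) *
          (Complex.I * ((lam * x μ t : ℝ) : ℂ) * wave γ μ t)
        = (1 - ((nearWeight θ (x μ t) : ℝ) : ℂ)) * wave γ μ t := by
      rw [← hsumC]
      push_cast
      field_simp
    rw [h3]
    ring
  · have hform : ∀ t, ‖∑ μ ∈ Elat lam, a μ * (((regInv θ (x μ t) : ℝ) : ℂ) / (Complex.I * lam)
        * wave γ μ t)‖ ^ 2 = 1 / (θ * lam) ^ 2 *
          ‖∑ μ ∈ Elat lam, a μ * (((θ * regInv θ (x μ t) : ℝ) : ℂ) * wave γ μ t)‖ ^ 2 := by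
      intro t
      have hθC : (θ : ℂ) ≠ 0 := by exact_mod_cast hθ.ne'
      have : ∑ μ ∈ Elat lam, a μ * (((regInv θ (x μ t) : ℝ) : ℂ) / (Complex.I * lam)
        * wave γ μ t) = (1 / (Complex.I * ((θ * lam : ℝ) : ℂ))) *
          ∑ μ ∈ Elat lam, a μ * (((θ * regInv θ (x μ t) : ℝ) : ℂ) * wave γ μ t) := by
        rw [Finset.mul_sum]
        refine Finset.sum_congr rfl fun μ _ => ?_
        push_cast
        field_simp
      rw [this, norm_mul, mul_pow, norm_div, norm_mul, Complex.norm_I, Complex.norm_real,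
        Real.norm_eq_abs, abs_of_pos (by positivity : 0 < θ * lam), norm_one, one_mul, div_pow,
        one_pow]
    simp_rw [hform]
    rw [intervalIntegral.integral_const_mul]
    have := (abs_le.mp bG).2
    calc _ ≤ 1 / (θ * lam) ^ 2 * ((2 * L + 2 * K) * S) := by
          gcongr
          have h2 : 2 * K * θ ≤ 2 * K := mul_le_of_le_one_right (by positivity) hθ1
          nlinarith [mul_le_mul_of_nonneg_right (hNτ.trans h2) hS0]
      _ = _ := by ring
  · have bE2 : ∀ t ∈ Set.Icc (0:ℝ) L, ‖E2 t‖ ^ 2 ≤ θ * S := by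
      intro t ht
      have h1 : ‖E2 t‖ ≤ ∑ μ ∈ Elat lam, ‖a μ‖ * (B / (θ ^ 2 * lam)) := by
        refine (norm_sum_le _ _).trans (Finset.sum_le_sum fun μ hμ => ?_)
        rw [norm_mul, norm_mul, norm_wave, mul_one, norm_div, norm_mul, Complex.norm_I,
          Complex.norm_real, Complex.norm_real, Real.norm_eq_abs, Real.norm_eq_abs,
          abs_of_pos hlam, one_mul, abs_mul]
        refine mul_le_mul_of_nonneg_left ?_ (norm_nonneg _)
        calc |regInvDeriv θ (x μ t)| * |x1 μ t| / lam ≤ (1 / θ ^ 2 * B) / lam := by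
              gcongr
              · exact abs_regInvDeriv_le hθ _
              · exact (hph μ hμ).bound1 t ht
          _ = _ := by field_simp
      rw [← Finset.sum_mul] at h1
      calc ‖E2 t‖ ^ 2 ≤ ((∑ μ ∈ Elat lam, ‖a μ‖) * (B / (θ ^ 2 * lam))) ^ 2 := by gcongr
        _ = (∑ μ ∈ Elat lam, ‖a μ‖) ^ 2 * (B / (θ ^ 2 * lam)) ^ 2 := by ring
        _ ≤ (N * S) * (B / (θ ^ 2 * lam)) ^ 2 := by
            gcongr
            exact sq_sum_le_card_mul_sum_sq
        _ = (N * B ^ 2) / (θ ^ 4 * lam ^ 2) * S := by ring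
        _ ≤ (θ ^ 5 * lam ^ 2) / (θ ^ 4 * lam ^ 2) * S := by gcongr
        _ = θ * S := by field_simp
    have i1 : (∫ t in (0:ℝ)..L, ‖E1 t‖ ^ 2) ≤ 4 * K * θ * S := by
      have := (abs_le.mp bE).2
      nlinarith [mul_le_mul_of_nonneg_right hNτ hS0]
    calc ∫ t in (0:ℝ)..L, ‖E1 t - E2 t‖ ^ 2
        ≤ ∫ t in (0:ℝ)..L, (2 * ‖E1 t‖ ^ 2 + 2 * (θ * S)) := by
          refine intervalIntegral.integral_mono_on hL
            (Continuous.intervalIntegrable (by fun_prop) _ _)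
            (Continuous.intervalIntegrable (by fun_prop) _ _) fun t ht => ?_
          have h1 := norm_sub_le (E1 t) (E2 t)
          have h2 := bE2 t ht
          calc ‖E1 t - E2 t‖ ^ 2 ≤ (‖E1 t‖ + ‖E2 t‖) ^ 2 := by gcongr
            _ ≤ 2 * ‖E1 t‖ ^ 2 + 2 * ‖E2 t‖ ^ 2 := by nlinarith [sq_nonneg (‖E1 t‖ - ‖E2 t‖)]
            _ ≤ _ := by gcongr
      _ = 2 * (∫ t in (0:ℝ)..L, ‖E1 t‖ ^ 2) + L * (2 * (θ * S)) := by
          have c1 : Continuous (fun t => 2 * ‖E1 t‖ ^ 2) := by fun_prop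
          rw [intervalIntegral.integral_add (c1.intervalIntegrable _ _)
              intervalIntegrable_const, intervalIntegral.integral_const_mul,
            intervalIntegral.integral_const, smul_eq_mul, sub_zero]
      _ ≤ 2 * (4 * K * θ * S) + L * (2 * (θ * S)) := by gcongr
      _ = _ := by ring

end IsUniformCurve

theorem card_le_three_mul_card_image {J : Finset ℕ} {z : ℕ → ℝ} {δ : ℝ} (hδ : 0 < δ)
    (hz : ∀ j ∈ J, ((j : ℝ) - 1) * δ ≤ z j ∧ z j ≤ ((j : ℝ) + 1) * δ) :
    J.card ≤ 3 * (J.image z).card := by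
  refine Finset.card_le_mul_card_image J 3 fun w _ => ?_
  rcases (J.filter fun j => z j = w).eq_empty_or_nonempty with he | hne
  · simp [he]
  · obtain ⟨i, hi, hmin⟩ := Finset.exists_min_image _ (fun j => j) hne
    have hsub : (J.filter fun j => z j = w) ⊆ Finset.Icc i (i + 2) := by
      intro j hj
      rw [Finset.mem_filter] at hi hj
      have h1 := (hz i hi.1).2
      have h2 := (hz j hj.1).1
      rw [hi.2] at h1
      rw [hj.2] at h2
      have h3 : (j : ℝ) - 1 ≤ (i : ℝ) + 1 := le_of_mul_le_mul_right (h2.trans h1) hδ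
      have h4 : (j : ℝ) ≤ ((i + 2 : ℕ) : ℝ) := by push_cast; linarith
      exact Finset.mem_Icc.mpr ⟨hmin j (Finset.mem_filter.mpr hj), by exact_mod_cast h4⟩
    calc _ ≤ (Finset.Icc i (i + 2)).card := Finset.card_le_card hsub
      _ = 3 := by rw [Nat.card_Icc]; omega

namespace IsUniformCurve

variable {L A B : ℝ} {γ : ℝ → ℝ × ℝ}

theorem eq_of_apply_eq (h : IsUniformCurve L A B γ) (hB : 1 ≤ B)
    (hunit : ∀ t ∈ Set.Icc (0:ℝ) L, (deriv γ t).1 ^ 2 + (deriv γ t).2 ^ 2 = 1)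
    {t s : ℝ} (ht : 0 ≤ t) (hs : s ≤ L) (hts : t ≤ s) (hd : (s - t) * B < 1) (he : γ t = γ s) :
    t = s := by
  by_contra hne
  have hlt : t < s := lt_of_le_of_ne hts hne
  have htI : t ∈ Set.Icc (0:ℝ) L := ⟨ht, hts.trans hs⟩
  have hp := h _ (hunit t htI)
  obtain ⟨r, hr, hr0⟩ := exists_hasDerivAt_eq_zero hlt
    hp.continuous_phase.continuousOn (by simp only [he]) (fun x _ => hp.deriv0 x)
  have hlip := (convex_Icc t s).norm_image_sub_le_of_norm_hasDerivWithin_le (C := B)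
    (fun y _ => (hp.deriv1 y).hasDerivWithinAt)
    (fun y hy => by
      rw [Real.norm_eq_abs]
      exact hp.bound1 y ⟨ht.trans hy.1, hy.2.trans hs⟩)
    (Set.left_mem_Icc.mpr hts) (Set.Ioo_subset_Icc_self hr)
  have h1 : dot (deriv γ t) (deriv γ t) = 1 := by
    rw [← hunit t htI, dot]
    ring
  simp only [hr0, h1, Real.norm_eq_abs] at hlip
  rw [zero_sub, abs_neg, abs_one, abs_of_pos (sub_pos.mpr hr.1)] at hlip
  have : B * (r - t) ≤ B * (s - t) := by
    have := hr.2
    gcongr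
  linarith

theorem exists_card_le_mul_card_image (h : IsUniformCurve L A B γ) (hB : 1 ≤ B)
    (hunit : ∀ t ∈ Set.Icc (0:ℝ) L, (deriv γ t).1 ^ 2 + (deriv γ t).2 ^ 2 = 1) :
    ∃ m : ℕ, ∀ Z : Finset ℝ, (∀ z ∈ Z, z ∈ Set.Icc (0:ℝ) L) → Z.card ≤ m * (Z.image γ).card := by
  have hB0 : 0 ≤ B := by linarith
  refine ⟨⌊L * B⌋₊ + 1, fun Z hZ => Finset.card_le_mul_card_image Z _ fun y _ => ?_⟩
  have key : ((Z.filter fun x => γ x = y).card) ≤ (Finset.range (⌊L * B⌋₊ + 1)).card := by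
    refine Finset.card_le_card_of_injOn (fun x => ⌊x * B⌋₊) ?_ ?_
    · intro x hx
      have hx' := hZ x (Finset.mem_filter.mp hx).1
      simp only [Finset.coe_range, Set.mem_Iio]
      exact Nat.lt_succ_of_le (Nat.floor_mono (mul_le_mul_of_nonneg_right hx'.2 hB0))
    · have hle : ∀ t s : ℝ, t ∈ Z → s ∈ Z → γ t = γ s → t ≤ s → ⌊t * B⌋₊ = ⌊s * B⌋₊ → t = s := by
        intro t s ht hs he hts hf
        have ht0 := hZ t ht
        have hs0 := hZ s hs
        refine h.eq_of_apply_eq hB hunit ht0.1 hs0.2 hts ?_ he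
        have h1 := Nat.floor_le (mul_nonneg ht0.1 hB0)
        have h2 := Nat.lt_floor_add_one (s * B)
        rw [hf] at h1
        linarith
      intro t ht s hs hf
      obtain ⟨htZ, hty⟩ := Finset.mem_filter.mp ht
      obtain ⟨hsZ, hsy⟩ := Finset.mem_filter.mp hs
      rcases le_total t s with hts | hts
      · exact hle t s htZ hsZ (hty.trans hsy.symm) hts hf
      · exact (hle s t hsZ htZ (hsy.trans hty.symm) hts hf.symm).symm
  simpa using key

end IsUniformCurve

theorem exists_card_pow_mul_rpow_le {κ : ℝ} (hκ : 0 < κ) :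
    ∃ lam0 ≥ (1:ℝ), ∀ lam ≥ lam0, ((Elat lam).card : ℝ) ^ 5 * lam ^ (-(1 / 9) : ℝ) ≤ κ := by
  obtain ⟨C, hC1, hC⟩ := exists_card_Elat_le_rpow (ε := 1 / 90) (by norm_num)
  have hlim : Filter.Tendsto (fun lam : ℝ => C ^ 5 * lam ^ (-(1 / 18) : ℝ)) Filter.atTop
      (nhds (C ^ 5 * 0)) := (tendsto_rpow_neg_atTop (by norm_num)).const_mul _
  rw [mul_zero] at hlim
  obtain ⟨l0, hl0⟩ := Filter.eventually_atTop.mp (hlim.eventually_le_const hκ)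
  refine ⟨max 1 l0, le_max_left _ _, fun lam hlam => ?_⟩
  have hpos : 0 < lam := lt_of_lt_of_le one_pos ((le_max_left _ _).trans hlam)
  calc ((Elat lam).card : ℝ) ^ 5 * lam ^ (-(1 / 9) : ℝ)
      ≤ (C * lam ^ (1 / 90 : ℝ)) ^ 5 * lam ^ (-(1 / 9) : ℝ) := by
        gcongr
        exact hC lam hpos
    _ = C ^ 5 * (lam ^ (1 / 18 : ℝ) * lam ^ (-(1 / 9) : ℝ)) := by
        rw [mul_pow, ← Real.rpow_natCast (lam ^ (1 / 90 : ℝ)), ← Real.rpow_mul hpos.le]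
        norm_num
        ring
    _ = C ^ 5 * lam ^ (-(1 / 18) : ℝ) := by
        rw [← Real.rpow_add hpos]
        norm_num
    _ ≤ κ := hl0 lam ((le_max_right _ _).trans hlam)

/-- Lower bound for the number of zeros of a function with an approximate primitive, in terms of
its normalized `L¹` norm `R`. -/
theorem exists_zeros_of_approx_primitive {f : ℝ → ℝ} (cf : Continuous f) {G E : ℝ → ℂ}
    (hG : ∀ t, HasDerivAt G ((f t : ℂ) - E t) t) (cE : Continuous E)
    {L K C1 c5 c9 lam s R : ℝ} (hL : 0 < L) (hK : 0 ≤ K) (hC1 : 0 < C1) (hc5 : 0 < c5)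
    (hc5b : c5 * (16 * L * (8 * K + 2 * L)) ≤ 1) (hlam : 0 < lam) (hs : 0 < s) (hR : 0 < R)
    (bG : (∫ t in (0:ℝ)..L, ‖G t‖ ^ 2) ≤ (2 * L + 2 * K) / (c5 * R ^ 2 * lam) ^ 2 * s ^ 2)
    (bE : (∫ t in (0:ℝ)..L, ‖E t‖ ^ 2) ≤ (8 * K + 2 * L) * (c5 * R ^ 2) * s ^ 2)
    (bf : (∫ t in (0:ℝ)..L, f t ^ 2) ≤ C1 * s ^ 2)
    (hI : (∫ t in (0:ℝ)..L, |f t|) = R * s)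
    (hc9 : c9 = L * c5 / (16 * (2 * L + K)))
    (h1 : 1 ≤ c9 * lam * R ^ 3) (h4 : 4 ≤ c9 / (16 * C1 * L) * lam * R ^ 5) :
    ∃ (J : Finset ℕ) (z : ℕ → ℝ), ∃ δ > 0,
      (∀ j ∈ J, z j ∈ Set.Icc 0 L ∧ f (z j) = 0 ∧
        ((j : ℝ) - 1) * δ ≤ z j ∧ z j ≤ ((j : ℝ) + 1) * δ) ∧
      c9 / (16 * C1 * L) / 2 * lam * R ^ 5 ≤ J.card := by
  have hc9p : 0 < c9 := by rw [hc9]; positivity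
  have cG : Continuous G := continuous_iff_continuousAt.mpr fun t => (hG t).continuousAt
  have iG : (∫ t in (0:ℝ)..L, ‖G t‖) ≤ (2 * L + K) * s / (c5 * R ^ 2 * lam) := by
    set w := c5 * R ^ 2 * lam with hw
    have hwp : 0 < w := by positivity
    calc (∫ t in (0:ℝ)..L, ‖G t‖)
        ≤ (s / w) * (L - 0) / 2 + 1 / (2 * (s / w)) * ∫ t in (0:ℝ)..L, ‖G t‖ ^ 2 :=
          integral_norm_le_amgm cG hL.le (by positivity)
      _ ≤ (s / w) * (L - 0) / 2 + 1 / (2 * (s / w)) * ((2 * L + 2 * K) / w ^ 2 * s ^ 2) := by gcongr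
      _ = (L / 2 + L + K) * s / w := by field_simp; ring
      _ ≤ (2 * L + K) * s / w := by gcongr; linarith
  have iG0 : 0 ≤ ∫ t in (0:ℝ)..L, ‖G t‖ :=
    intervalIntegral.integral_nonneg hL.le fun t _ => norm_nonneg _
  have iE : (∫ t in (0:ℝ)..L, ‖E t‖) ≤ R * s / 4 := by
    calc (∫ t in (0:ℝ)..L, ‖E t‖)
        ≤ (R * s / (4 * L)) * (L - 0) / 2
          + 1 / (2 * (R * s / (4 * L))) * ∫ t in (0:ℝ)..L, ‖E t‖ ^ 2 :=
          integral_norm_le_amgm cE hL.le (by positivity)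
      _ ≤ (R * s / (4 * L)) * (L - 0) / 2
          + 1 / (2 * (R * s / (4 * L))) * ((8 * K + 2 * L) * (c5 * R ^ 2) * s ^ 2) := by gcongr
      _ = R * s / 8 + c5 * (16 * L * (8 * K + 2 * L)) * (R * s / 8) := by field_simp; ring
      _ ≤ R * s / 8 + 1 * (R * s / 8) := by gcongr
      _ = _ := by ring
  set M := ⌊c9 * lam * R ^ 3⌋₊ with hM
  have hM1 : 1 ≤ M := by rw [hM, Nat.one_le_floor_iff]; exact h1
  have hMR : (1:ℝ) ≤ M := by exact_mod_cast hM1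
  have hMle : (M : ℝ) ≤ c9 * lam * R ^ 3 := Nat.floor_le (by positivity)
  have hMge : c9 * lam * R ^ 3 / 2 ≤ M := by
    have := Nat.lt_floor_add_one (c9 * lam * R ^ 3)
    rw [← hM] at this
    linarith
  obtain ⟨J, z, hz, hJ⟩ := exists_zeros_of_integral_abs cf hG cE (L := L) (δ := L / M)
    (η := 4 * C1 * s / R) (by positivity) (by positivity) (M := M) (by field_simp) hM1
  refine ⟨J, z, L / M, by positivity, hz, ?_⟩
  have t1 : 2 / (L / M) * (∫ t in (0:ℝ)..L, ‖G t‖) ≤ R * s / 8 := by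
    calc 2 / (L / M) * (∫ t in (0:ℝ)..L, ‖G t‖)
        = 2 * M / L * (∫ t in (0:ℝ)..L, ‖G t‖) := by field_simp
      _ ≤ 2 * (c9 * lam * R ^ 3) / L * ((2 * L + K) * s / (c5 * R ^ 2 * lam)) := by
          gcongr
      _ = R * s / 8 := by rw [hc9]; field_simp; norm_num
  have t2 : 1 / (2 * (4 * C1 * s / R)) * (∫ t in (0:ℝ)..L, f t ^ 2) ≤ R * s / 8 := by
    calc 1 / (2 * (4 * C1 * s / R)) * (∫ t in (0:ℝ)..L, f t ^ 2)
        ≤ 1 / (2 * (4 * C1 * s / R)) * (C1 * s ^ 2) := by gcongr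
      _ = R * s / 8 := by field_simp; norm_num
  rw [hI] at hJ
  have t3 : R * s / 2 ≤ 4 * C1 * s / R * (L / M) * (J.card + 2) := by linarith
  have t4 : 4 * C1 * s / R * (L / M) * (J.card + 2)
      ≤ 4 * C1 * s / R * (L / (c9 * lam * R ^ 3 / 2)) * (J.card + 2) := by gcongr
  have t5 : c9 / (16 * C1 * L) * lam * R ^ 5 ≤ J.card + 2 := by
    have := t3.trans t4
    have e : c9 / (16 * C1 * L) * lam * R ^ 5
        = R * s / 2 / (4 * C1 * s / R * (L / (c9 * lam * R ^ 3 / 2))) := by field_simp; norm_num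
    rw [e, div_le_iff₀ (by positivity)]
    linarith
  linarith

/-- Consequences of the smallness of `N⁵ τ`, where `λ = τ⁻⁹`. -/
theorem smallness_bounds {N τ lam κ b B R c5 c8 c9 : ℝ} (hN : 1 ≤ N) (hτ : 0 < τ) (hτ1 : τ ≤ 1)
    (hlt : lam * τ ^ 9 = 1) (hlam : 0 < lam) (hρ : N ^ 5 * τ ≤ κ) (hb : 0 < b) (hB : 0 < B)
    (hc5 : 0 < c5) (hc8 : 0 < c8) (hc9 : 0 < c9) (hR : b / N ≤ R)
    (k1 : κ ≤ 1) (k4 : κ ≤ (c5 * b ^ 2) ^ 2 / B) (k5 : κ ≤ (c5 * b ^ 2) ^ 5 / B ^ 2)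
    (k6 : κ ≤ c9 * b ^ 3) (k7 : κ ≤ c8 * b ^ 5 / 4) :
    B * N * τ ≤ (c5 * R ^ 2) ^ 2 ∧ N * B ^ 2 ≤ (c5 * R ^ 2) ^ 5 * lam ^ 2 ∧
      1 ≤ c9 * lam * R ^ 3 ∧ 4 ≤ c8 * lam * R ^ 5 := by
  have hN0 : 0 < N := by linarith
  have hτlam : 1 ≤ lam * τ := by
    rw [← hlt]
    gcongr
    exact pow_le_of_le_one hτ.le hτ1 (by norm_num)
  have hθ : c5 * b ^ 2 / N ^ 2 ≤ c5 * R ^ 2 := by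
    calc c5 * b ^ 2 / N ^ 2 = c5 * (b / N) ^ 2 := by ring
      _ ≤ c5 * R ^ 2 := by gcongr
  refine ⟨?_, ?_, ?_, ?_⟩
  · calc B * N * τ = B * (N ^ 5 * τ) / N ^ 4 := by field_simp
      _ ≤ B * ((c5 * b ^ 2) ^ 2 / B) / N ^ 4 := by
          gcongr
          exact hρ.trans k4
      _ = (c5 * b ^ 2 / N ^ 2) ^ 2 := by field_simp
      _ ≤ _ := by gcongr
  · have h3 : N ^ 11 * τ ^ 18 ≤ κ := by
      calc N ^ 11 * τ ^ 18 ≤ N ^ 15 * τ ^ 3 := by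
            gcongr ?_ * ?_
            · exact pow_le_pow_right₀ hN (by norm_num)
            · exact pow_le_pow_of_le_one hτ.le hτ1 (by norm_num)
        _ = (N ^ 5 * τ) ^ 3 := by ring
        _ ≤ N ^ 5 * τ := pow_le_of_le_one (by positivity) (hρ.trans k1) (by norm_num)
        _ ≤ κ := hρ
    calc N * B ^ 2 = B ^ 2 * (N ^ 11 * τ ^ 18) / N ^ 10 * lam ^ 2 := by
          have : τ ^ 18 * lam ^ 2 = 1 := by
            calc τ ^ 18 * lam ^ 2 = (lam * τ ^ 9) ^ 2 := by ring
              _ = 1 := by rw [hlt, one_pow]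
          field_simp
          linear_combination (-1 : ℝ) * this
      _ ≤ B ^ 2 * ((c5 * b ^ 2) ^ 5 / B ^ 2) / N ^ 10 * lam ^ 2 := by
          gcongr
          exact h3.trans k5
      _ = (c5 * b ^ 2 / N ^ 2) ^ 5 * lam ^ 2 := by field_simp
      _ ≤ _ := by gcongr
  · calc 1 ≤ lam * τ := hτlam
      _ ≤ lam * (N ^ 2 * τ) := by
          gcongr
          exact le_mul_of_one_le_left hτ.le (one_le_pow₀ hN)
      _ = lam * (N ^ 5 * τ) / N ^ 3 := by field_simp
      _ ≤ lam * (c9 * b ^ 3) / N ^ 3 := by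
          have := hρ.trans k6
          exact div_le_div_of_nonneg_right (mul_le_mul_of_nonneg_left this hlam.le) (by positivity)
      _ = c9 * lam * (b / N) ^ 3 := by ring
      _ ≤ c9 * lam * R ^ 3 := by gcongr
  · calc 4 ≤ 4 * (lam * τ) := by linarith
      _ = 4 * (lam * (N ^ 5 * τ) / N ^ 5) := by field_simp
      _ ≤ 4 * (lam * (c8 * b ^ 5 / 4) / N ^ 5) := by
          gcongr
          exact hρ.trans k7
      _ = c8 * lam * (b / N) ^ 5 := by ring
      _ ≤ c8 * lam * R ^ 5 := by gcongr

namespace IsUniformCurve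

variable {L A B : ℝ} {γ : ℝ → ℝ × ℝ}

/-- For lattice circles with few points, the `L¹` and `L²` norms of the restriction of an
eigenfunction are controlled by the `ℓ²` norm of the coefficients. -/
theorem restriction_bounds (h : IsUniformCurve L A B γ) (cγ : Continuous γ)
    (hL : 0 < L) (hA : 0 ≤ A) (hB : 1 ≤ B) {c : ℝ} (hc : 0 < c) (hcL : c ≤ L)
    (hwave : ∀ ξ : ℤ × ℤ, ξ ≠ 0 → ‖∫ t in (0:ℝ)..L, wave γ ξ t‖ ≤ L - c)
    {lam τ : ℝ} (hτ : 0 < τ) (hτ1 : τ ≤ 1) (hlt : 1 ≤ lam * τ ^ 9) (a : ℤ × ℤ → ℂ)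
    {s : ℝ} (hs : 0 < s) (hsS : s ^ 2 = ∑ μ ∈ Elat lam, ‖a μ‖ ^ 2)
    (hN1 : (Elat lam).card * (decayConst L A B * 2 * τ) ≤ 1)
    (hNc : (Elat lam).card * (decayConst L A B * 2 * τ) ≤ c / 2) :
    (∫ t in (0:ℝ)..L, ‖efn lam a (γ t)‖ ^ 2) ≤ (2 * L + 1) * s ^ 2 ∧
    (∫ t in (0:ℝ)..L, ‖efn lam a (γ t)‖) ≤ (2 * L + 1) * s ∧
    c / 2 * s ≤ (Elat lam).card * ∫ t in (0:ℝ)..L, ‖efn lam a (γ t)‖ := by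
  have hB0 : 0 ≤ B := by linarith
  have cf : Continuous (fun t => efn lam a (γ t)) := by
    simp_rw [efn_comp_eq_sum_wave]
    exact continuous_finsetSum _ fun μ _ => continuous_const.mul (continuous_wave cγ μ)
  have hlow := (abs_le.mp (h.abs_integral_norm_efn_sq_sub_le cγ hL.le hA hB0 hτ hτ1 hlt a
    (P := L - c) (by linarith) hwave)).1
  have hup := (abs_le.mp (h.abs_integral_norm_efn_sq_sub_le cγ hL.le hA hB0 hτ hτ1 hlt a
    (P := L) hL.le fun ξ hξ => (hwave ξ hξ).trans (by linarith))).2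
  rw [← hsS] at hlow hup
  set N : ℝ := ((Elat lam).card : ℝ) with hN
  have hs2 : 0 < s ^ 2 := by positivity
  have h1 : (∫ t in (0:ℝ)..L, ‖efn lam a (γ t)‖ ^ 2) ≤ (2 * L + 1) * s ^ 2 := by
    nlinarith [mul_le_mul_of_nonneg_right hN1 hs2.le]
  have h2 : c / 2 * s ^ 2 ≤ ∫ t in (0:ℝ)..L, ‖efn lam a (γ t)‖ ^ 2 := by
    nlinarith [mul_le_mul_of_nonneg_right hNc hs2.le]
  refine ⟨h1, ?_, ?_⟩
  · refine (integral_norm_le_amgm cf hL.le hs).trans ?_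
    calc s * (L - 0) / 2 + 1 / (2 * s) * ∫ t in (0:ℝ)..L, ‖efn lam a (γ t)‖ ^ 2
        ≤ s * (L - 0) / 2 + 1 / (2 * s) * ((2 * L + 1) * s ^ 2) := by gcongr
      _ = (L / 2 + (2 * L + 1) / 2) * s := by field_simp; ring
      _ ≤ (2 * L + 1) * s := mul_le_mul_of_nonneg_right (by linarith) hs.le
  · have hsup : ∀ t, ‖efn lam a (γ t)‖ ≤ N * s := by
      intro t
      refine (norm_efn_le lam a (γ t)).trans ?_
      rw [← hsS, Real.sqrt_sq hs.le]
      gcongr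
      rw [Real.sqrt_le_left (by positivity), ← hN, hN]
      exact_mod_cast Nat.le_self_pow two_ne_zero _
    have h3 : (∫ t in (0:ℝ)..L, ‖efn lam a (γ t)‖ ^ 2)
        ≤ ∫ t in (0:ℝ)..L, (N * s) * ‖efn lam a (γ t)‖ := by
      refine intervalIntegral.integral_mono_on hL.le
        (Continuous.intervalIntegrable (by fun_prop) _ _)
        (Continuous.intervalIntegrable (by fun_prop) _ _) fun t _ => ?_
      rw [sq]
      gcongr
      exact hsup t
    rw [intervalIntegral.integral_const_mul] at h3
    have : (c / 2 * s) * s ≤ (N * ∫ t in (0:ℝ)..L, ‖efn lam a (γ t)‖) * s := by nlinarith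
    exact le_of_mul_le_mul_right this hs

theorem exists_zeros (h : IsUniformCurve L A B γ) (cγ : Continuous γ)
    (hL : 0 < L) (hA : 0 ≤ A) (hB : 1 ≤ B) :
    ∃ κ > 0, ∃ c0 > 0, ∀ lam τ : ℝ, 0 < τ → τ ≤ 1 → lam * τ ^ 9 = 1 →
      ((Elat lam).card : ℝ) ^ 5 * τ ≤ κ →
      ∀ a : ℤ × ℤ → ℂ, (∀ μ : ℤ × ℤ, a (-μ) = starRingEnd ℂ (a μ)) →
      ∀ s > 0, s ^ 2 = ∑ μ ∈ Elat lam, ‖a μ‖ ^ 2 →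
      ∃ (J : Finset ℕ) (z : ℕ → ℝ), ∃ δ > 0,
        (∀ j ∈ J, z j ∈ Set.Icc 0 L ∧ efn lam a (γ (z j)) = 0 ∧
          ((j : ℝ) - 1) * δ ≤ z j ∧ z j ≤ ((j : ℝ) + 1) * δ) ∧
        c0 * lam * ((∫ t in (0:ℝ)..L, ‖efn lam a (γ t)‖) / s) ^ 5 ≤ J.card := by
  have hB0 : 0 < B := by linarith
  obtain ⟨c, hc, hcL, hwave⟩ := h.exists_norm_integral_wave_le hL hA
  obtain ⟨K, hK⟩ : ∃ K, K = decayConst L A B := ⟨_, rfl⟩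
  have hK0 : 0 ≤ K := hK ▸ decayConst_nonneg hL.le hA hB0.le
  obtain ⟨C1, hC1⟩ : ∃ C1, C1 = 2 * L + 1 := ⟨_, rfl⟩
  have hC1p : 1 ≤ C1 := by linarith
  obtain ⟨c5, hc5, hc5a, hc5b⟩ :
      ∃ c5 > 0, c5 * C1 ^ 2 ≤ 1 ∧ c5 * (16 * L * (8 * K + 2 * L)) ≤ 1 := by
    refine ⟨min (1 / C1 ^ 2) (1 / (16 * L * (8 * K + 2 * L))), by positivity, ?_, ?_⟩
    · rw [← le_div_iff₀ (by positivity)]; exact min_le_left _ _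
    · rw [← le_div_iff₀ (by positivity)]; exact min_le_right _ _
  obtain ⟨C6, hC6⟩ : ∃ C6, C6 = 2 * L + K := ⟨_, rfl⟩
  have hC6p : 0 < C6 := by linarith
  obtain ⟨c9, hc9⟩ : ∃ c9, c9 = L * c5 / (16 * C6) := ⟨_, rfl⟩
  have hc9p : 0 < c9 := by rw [hc9]; positivity
  obtain ⟨c8, hc8⟩ : ∃ c8, c8 = c9 / (16 * C1 * L) := ⟨_, rfl⟩
  have hc8p : 0 < c8 := by rw [hc8]; positivity
  obtain ⟨κ, hκ, k1, k2, k3, k4, k5, k6, k7⟩ : ∃ κ > 0, κ ≤ 1 ∧ κ ≤ 1 / (2 * K + 1) ∧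
      κ ≤ c / 2 / (2 * K + 1) ∧ κ ≤ (c5 * (c / 2) ^ 2) ^ 2 / B ∧
      κ ≤ (c5 * (c / 2) ^ 2) ^ 5 / B ^ 2 ∧ κ ≤ c9 * (c / 2) ^ 3 ∧ κ ≤ c8 * (c / 2) ^ 5 / 4 := by
    refine ⟨min 1 (min (1 / (2 * K + 1)) (min (c / 2 / (2 * K + 1))
      (min ((c5 * (c / 2) ^ 2) ^ 2 / B) (min ((c5 * (c / 2) ^ 2) ^ 5 / B ^ 2)
      (min (c9 * (c / 2) ^ 3) (c8 * (c / 2) ^ 5 / 4)))))), by positivity, ?_⟩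
    simp only [min_le_iff, le_refl, true_or, or_true, and_self]
  refine ⟨κ, hκ, c8 / 2, by positivity, fun lam τ hτ hτ1 hlt hρ a ha s hs hsS => ?_⟩
  have hlam : 0 < lam := by
    by_contra hneg
    nlinarith [pow_pos hτ 9, mul_nonneg (sub_nonneg.mpr (not_lt.mp hneg)) (pow_pos hτ 9).le]
  have hN1 : (1:ℝ) ≤ (Elat lam).card := by
    have : 0 < (Elat lam).card := by
      rw [Finset.card_pos]
      by_contra hne
      rw [Finset.not_nonempty_iff_eq_empty] at hne
      rw [hne, Finset.sum_empty] at hsS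
      nlinarith
    exact_mod_cast this
  have hrest := h.restriction_bounds cγ hL hA hB hc hcL hwave hτ hτ1 hlt.ge a hs hsS
  have happ := fun θ hθ hθ1 => h.exists_approx_primitive cγ hL.le hA hB hlam hτ hτ1 hlt.ge
    (θ := θ) hθ hθ1 a
  rw [← hK] at hrest
  rw [← hK, ← hsS] at happ
  obtain ⟨N, hN⟩ : ∃ N : ℝ, N = (Elat lam).card := ⟨_, rfl⟩
  rw [← hN] at hrest happ hN1 hρ
  have hNp : 0 < N := by linarith
  have hNτ : N * τ ≤ κ := by
    refine le_trans ?_ hρ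
    gcongr
    exact le_self_pow₀ hN1 (by norm_num)
  have hNK : N * (K * 2 * τ) ≤ κ * (2 * K + 1) := by
    calc N * (K * 2 * τ) = N * τ * (2 * K) := by ring
      _ ≤ κ * (2 * K + 1) := by gcongr; linarith
  obtain ⟨r1, r2, r3⟩ := hrest
    (hNK.trans ((le_div_iff₀ (by positivity)).mp k2))
    (hNK.trans ((le_div_iff₀ (by positivity)).mp k3))
  rw [← hC1] at r1 r2
  obtain ⟨R, hR⟩ : ∃ R, R = (∫ t in (0:ℝ)..L, ‖efn lam a (γ t)‖) / s := ⟨_, rfl⟩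
  have hI : (∫ t in (0:ℝ)..L, ‖efn lam a (γ t)‖) = R * s := by rw [hR]; field_simp
  rw [← hR]
  rw [hI] at r2 r3
  have hRC : R ≤ C1 := le_of_mul_le_mul_right r2 hs
  have hRN : c / 2 ≤ N * R := by
    refine le_of_mul_le_mul_right ?_ hs
    linarith
  have hRp : 0 < R := by
    by_contra hneg
    nlinarith
  have hRN2 : c / 2 / N ≤ R := by
    rw [div_le_iff₀ hNp]; linarith
  obtain ⟨q1, q2, q3, q4⟩ := smallness_bounds hN1 hτ hτ1 hlt hlam hρ (half_pos hc) hB0 hc5 hc8p hc9p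
    hRN2 k1 k4 k5 k6 k7
  have hθ1 : c5 * R ^ 2 ≤ 1 := by
    refine le_trans ?_ hc5a
    gcongr
  obtain ⟨G, E, hG, cE, bG, bE⟩ := happ (c5 * R ^ 2) (by positivity) hθ1 q1 q2
  have cf : Continuous (fun t => (efn lam a (γ t)).re) := by
    simp_rw [efn_comp_eq_sum_wave]
    exact Complex.continuous_re.comp
      (continuous_finsetSum _ fun μ _ => continuous_const.mul (continuous_wave cγ μ))
  rw [hc8] at q4 ⊢
  simp_rw [norm_efn ha, sq_abs] at r1 hI
  obtain ⟨J, z, δ, hδ, hz, hJ⟩ := exists_zeros_of_approx_primitive cf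
    (fun t => (hG t).congr_deriv (by rw [ofReal_re_efn ha]))
    cE hL hK0 (by linarith) hc5 hc5b hlam hs
    hRp bG bE r1 hI (by rw [hc9, hC6]) q3 q4
  refine ⟨J, z, δ, hδ, fun j hj => ⟨(hz j hj).1, ?_, (hz j hj).2.2⟩, hJ⟩
  rw [← ofReal_re_efn ha, (hz j hj).2.1, Complex.ofReal_zero]

end IsUniformCurve

/-- Theorem 1.2: for a smooth curve with nowhere-zero curvature, the number of nodal
intersections satisfies `N_{F,C} ≫ lam · (∫_C |F| / ‖F‖₂)⁵`. -/
theorem nodal_count_via_L1_restriction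
    (L Kmin Kmax : ℝ) (γ : ℝ → ℝ × ℝ)
    (hL : 0 < L) (hKmin : 0 < Kmin)
    (hsmooth : ContDiff ℝ (⊤ : ℕ∞) γ)
    (hunit : ∀ t ∈ Set.Icc (0:ℝ) L, e2 (deriv γ t) = 1)
    (hcurv : ∀ t ∈ Set.Icc (0:ℝ) L,
      Kmin ≤ e2 (deriv (deriv γ) t) ∧ e2 (deriv (deriv γ) t) ≤ Kmax) :
    ∃ c > (0:ℝ), ∃ lam0 > (0:ℝ), ∀ lam : ℝ, lam0 ≤ lam →
      ∀ a : ℤ × ℤ → ℂ,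
        (∀ μ : ℤ × ℤ, a (-μ) = starRingEnd ℂ (a μ)) →
        (∃ μ ∈ Elat lam, a μ ≠ 0) →
        ∃ T : Finset (ℝ × ℝ),
          (↑T : Set (ℝ × ℝ)) ⊆ {x | efn lam a x = 0} ∩ (γ '' Set.Icc 0 L) ∧
          c * lam * ((∫ t in (0:ℝ)..L, ‖efn lam a (γ t)‖) / l2T (efn lam a)) ^ 5
            ≤ T.card := by
  have cγ := hsmooth.continuous
  have hu : ∀ t ∈ Set.Icc (0:ℝ) L, (deriv γ t).1 ^ 2 + (deriv γ t).2 ^ 2 = 1 := fun t ht => by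
    rw [← e2_sq, hunit t ht, one_pow]
  obtain ⟨A, B, hA, hB, h⟩ := exists_isUniformCurve hL hKmin hsmooth hunit
    fun t ht => (hcurv t ht).1
  obtain ⟨m, hm⟩ := h.exists_card_le_mul_card_image hB hu
  obtain ⟨κ, hκ, c0, hc0, hzeros⟩ := h.exists_zeros cγ hL hA hB
  obtain ⟨lam0, hlam0, hN⟩ := exists_card_pow_mul_rpow_le hκ
  refine ⟨c0 / (3 * (m + 1)), by positivity, lam0, by linarith, fun lam hlam a ha hne => ?_⟩
  have hlam1 : 1 ≤ lam := hlam0.trans hlam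
  have hlamp : 0 < lam := by linarith
  set S := ∑ μ ∈ Elat lam, ‖a μ‖ ^ 2 with hS
  have hSpos : 0 < S := by
    obtain ⟨μ, hμ, hμ0⟩ := hne
    exact Finset.sum_pos' (fun _ _ => by positivity) ⟨μ, hμ, by positivity⟩
  obtain ⟨J, z, δ, hδ, hz, hJ⟩ := hzeros lam (lam ^ (-(1 / 9) : ℝ)) (by positivity)
    (Real.rpow_le_one_of_one_le_of_nonpos hlam1 (by norm_num))
    (by
      rw [← Real.rpow_natCast (lam ^ (-(1 / 9) : ℝ)), ← Real.rpow_mul hlamp.le]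
      norm_num
      rw [Real.rpow_neg_one, mul_inv_cancel₀ hlamp.ne'])
    (hN lam hlam) a ha (√S) (Real.sqrt_pos.mpr hSpos) (Real.sq_sqrt hSpos.le)
  refine ⟨(J.image z).image γ, ?_, ?_⟩
  · intro x hx
    simp only [Finset.coe_image, Set.mem_image, Finset.mem_coe] at hx
    obtain ⟨_, ⟨j, hj, rfl⟩, rfl⟩ := hx
    exact ⟨(hz j hj).2.1, z j, (hz j hj).1, rfl⟩
  · have c1 := card_le_three_mul_card_image hδ fun j hj => (hz j hj).2.2
    have c2 := hm (J.image z) fun w hw => by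
      obtain ⟨j, hj, rfl⟩ := Finset.mem_image.mp hw
      exact (hz j hj).1
    have c3 : (J.card : ℝ) ≤ 3 * (m + 1) * ((J.image z).image γ).card := by
      have : J.card ≤ 3 * (m + 1) * ((J.image z).image γ).card := by nlinarith
      exact_mod_cast this
    set I := ∫ t in (0:ℝ)..L, ‖efn lam a (γ t)‖ with hI
    have hI0 : 0 ≤ I := intervalIntegral.integral_nonneg hL.le fun t _ => norm_nonneg _
    have hl2 : I / l2T (efn lam a) ≤ I / √S := by
      rw [l2T_efn]
      have : √S ≤ 2 * π * √S :=
        le_mul_of_one_le_left (Real.sqrt_nonneg _) (by linarith [Real.pi_gt_three])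
      have := Real.sqrt_pos.mpr hSpos
      gcongr
    have hl0 : 0 ≤ I / l2T (efn lam a) := div_nonneg hI0 (Real.sqrt_nonneg _)
    calc c0 / (3 * (m + 1)) * lam * (I / l2T (efn lam a)) ^ 5
        ≤ c0 / (3 * (m + 1)) * lam * (I / √S) ^ 5 := by gcongr
      _ = c0 * lam * (I / √S) ^ 5 / (3 * (m + 1)) := by ring
      _ ≤ _ := by
          rw [div_le_iff₀ (by positivity)]
          linarith
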